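/- Let 0 < ε < 1, 0 < μ ≤ 1 and C > 0 be constants. There exist constants r₀ and c (depending only on C, ε and μ) such that the following holds for all sufficiently large n. Let A = (a_{ij}) be an n×n real matrix with ρ_b^{(μ)}(A) ≥ n^{−C}. Then there exist index sets I₀, J₀ ⊆ {1,…,n} with |I₀|, |J₀| ≤ r₀, index sets I, J ⊆ {1,…,n} with |I|, |J| ≥ n − c·n^ε, I ∩ I₀ = ∅ and J ∩ J₀ = ∅, nonzero integers k, l with |k|, |l| ≤ n^c, integers k_{i i₀} (i ∈ I, i₀ ∈ I₀) and l_{j₀ j} (j ∈ J, j₀ ∈ J₀) all of absolute value at most n^c, and real numbers a'_{ij} (i ∈ I, j ∈ J), such that for every i ∈ I: (i) a_{ij} = a'_{ij}/(kl) − Σ_{i₀∈I₀} k_{i i₀} a_{i₀ j}/k − Σ_{j₀∈J₀} l_{j₀ j} a_{i j₀}/l for all j ∈ J; and (ii) all but at most c·n^ε of the numbers a'_{ij}, j ∈ J, belong to a proper symmetric GAP Q_i (which may depend on i) of rank at most r₀ and size at most n^c. -/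

import Mathlib

open scoped Classical BigOperators

noncomputable section

/-- `Q` is a proper symmetric generalized arithmetic progression (GAP) of rank at most `r`
and size at most `s`. -/
def IsProperSymGAPSet (Q : Set ℝ) (r : ℕ) (s : ℝ) : Prop :=
  ∃ (r' : ℕ) (g : Fin r' → ℝ) (N : Fin r' → ℕ),
    r' ≤ r ∧
    Q = {x : ℝ | ∃ m : Fin r' → ℤ, (∀ i, |m i| ≤ (N i : ℤ)) ∧ x = ∑ i, (m i : ℝ) * g i} ∧
    (∀ m m' : Fin r' → ℤ, (∀ i, |m i| ≤ (N i : ℤ)) → (∀ i, |m' i| ≤ (N i : ℤ)) →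
      (∑ i, (m i : ℝ) * g i) = (∑ i, (m' i : ℝ) * g i) → m = m') ∧
    (∏ i, (2 * (N i : ℝ) + 1)) ≤ s

/-- The three possible values of the lazy sign `η^μ`: `+1`, `-1`, `0`. -/
def etaV : Fin 3 → ℝ := ![1, -1, 0]

/-- The corresponding probability weights: `μ/2`, `μ/2`, `1 - μ`. -/
def etaW (μ : ℝ) : Fin 3 → ℝ := ![μ / 2, μ / 2, 1 - μ]

/-- Probability of an event for a family of iid copies of `η^μ` (the random variable equal
to `±1` with probability `μ/2` each and `0` with probability `1 - μ`), indexed by a finite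
type. -/
def probEta (μ : ℝ) {ι : Type} [Fintype ι] (E : (ι → ℝ) → Prop) : ℝ :=
  ∑ s : ι → Fin 3, (∏ i, etaW μ (s i)) * (if E fun i => etaV (s i) then 1 else 0)

/-- The weighted bilinear concentration probability
`ρ_b^{(μ)}(A) = sup_a P(Σ a_{ij} x_i y_j = a)`, where the `x_i, y_j` are iid copies
of `η^μ`. -/
def rhoBmu (μ : ℝ) (n : ℕ) (A : Matrix (Fin n) (Fin n) ℝ) : ℝ :=
  ⨆ a : ℝ, probEta μ (fun xy : (Fin n ⊕ Fin n) → ℝ =>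
    ∑ i, ∑ j, A i j * xy (Sum.inl i) * xy (Sum.inr j) = a)

open AddMonoidAlgebra in
/-- The law of `b * η^μ`, as an element of the group algebra of `ℝ`. -/
def lazyStep (μ b : ℝ) : AddMonoidAlgebra ℝ ℝ :=
  single 0 (1 - μ) + single b (μ / 2) + single (-b) (μ / 2)

/-- The law of `∑ j ∈ S, b j * y j` for iid copies `y j` of `η^μ`. -/
def lazyLaw (μ : ℝ) {n : ℕ} (b : Fin n → ℝ) (S : Finset (Fin n)) : AddMonoidAlgebra ℝ ℝ :=
  ∏ j ∈ S, lazyStep μ (b j)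

/-- The embedding of finitely supported functions on `ℝ` into `ℓ²(ℝ)`. -/
def toL2 : AddMonoidAlgebra ℝ ℝ →ₗ[ℝ] lp (fun _ : ℝ => ℝ) 2 :=
  (Finsupp.linearCombination ℝ fun x : ℝ => lp.single 2 x (1 : ℝ)) ∘ₗ
    { toFun := AddMonoidAlgebra.coeff
      map_add' := fun _ _ => rfl
      map_smul' := fun _ _ => rfl }

/-- Translation by `v` on `ℓ²(ℝ)`, restricted to finitely supported functions. -/
def transL2 (v : ℝ) (p : AddMonoidAlgebra ℝ ℝ) : lp (fun _ : ℝ => ℝ) 2 :=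
  toL2 (AddMonoidAlgebra.single v 1 * p)

lemma toL2_single (x r : ℝ) : toL2 (AddMonoidAlgebra.single x r) = r • lp.single 2 x (1 : ℝ) := by
  exact Finsupp.linearCombination_single ℝ r x

lemma inner_toL2_single (x y r s : ℝ) :
    inner ℝ (toL2 (AddMonoidAlgebra.single x r)) (toL2 (AddMonoidAlgebra.single y s)) =
      if x = y then r * s else 0 := by
  rw [toL2_single, toL2_single, inner_smul_left, inner_smul_right, lp.inner_single_left]
  by_cases h : x = y
  · subst h; simp
  · simp [h, lp.single_apply]

lemma norm_toL2_single_one (x : ℝ) : ‖toL2 (AddMonoidAlgebra.single x 1)‖ = 1 := by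
  rw [toL2_single, one_smul, lp.norm_single (by norm_num), norm_one]

lemma inner_transL2 (v : ℝ) (p q : AddMonoidAlgebra ℝ ℝ) :
    inner ℝ (transL2 v p) (transL2 v q) = inner ℝ (toL2 p) (toL2 q) := by
  unfold transL2
  induction p using AddMonoidAlgebra.induction_linear with
  | zero => simp
  | add x y hx hy => simp only [mul_add, map_add, inner_add_left, hx, hy]
  | single m r =>
    induction q using AddMonoidAlgebra.induction_linear with
    | zero => simp
    | add x y hx hy => simp only [mul_add, map_add, inner_add_right, hx, hy]
    | single m' r' =>
      simp [AddMonoidAlgebra.single_mul_single, inner_toL2_single]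

lemma transL2_sub (v : ℝ) (p q : AddMonoidAlgebra ℝ ℝ) :
    transL2 v (p - q) = transL2 v p - transL2 v q := by
  simp [transL2, mul_sub]

lemma norm_transL2 (v : ℝ) (p : AddMonoidAlgebra ℝ ℝ) : ‖transL2 v p‖ = ‖toL2 p‖ := by
  rw [norm_eq_sqrt_real_inner, inner_transL2, ← norm_eq_sqrt_real_inner]

lemma transL2_zero (p : AddMonoidAlgebra ℝ ℝ) : transL2 0 p = toL2 p := by
  simp [transL2, ← AddMonoidAlgebra.one_def]

lemma transL2_add (u v : ℝ) (p : AddMonoidAlgebra ℝ ℝ) :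
    transL2 (u + v) p = transL2 u (AddMonoidAlgebra.single v 1 * p) := by
  simp [transL2, ← mul_assoc, AddMonoidAlgebra.single_mul_single]

lemma norm_transL2_sub (w u v : ℝ) (p : AddMonoidAlgebra ℝ ℝ) :
    ‖transL2 (w + u) p - transL2 (w + v) p‖ = ‖transL2 u p - transL2 v p‖ := by
  rw [transL2_add, transL2_add, ← transL2_sub, norm_transL2, map_sub]
  rfl

/-- The `ℓ²` distance between `p` and its translate by `v`. -/
def shiftDist (p : AddMonoidAlgebra ℝ ℝ) (v : ℝ) : ℝ := ‖transL2 v p - toL2 p‖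

lemma shiftDist_zero (p : AddMonoidAlgebra ℝ ℝ) : shiftDist p 0 = 0 := by
  simp [shiftDist, transL2_zero]

lemma shiftDist_add (p : AddMonoidAlgebra ℝ ℝ) (u v : ℝ) :
    shiftDist p (u + v) ≤ shiftDist p u + shiftDist p v := by
  have h := norm_transL2_sub u v 0 p
  rw [add_zero, transL2_zero] at h
  unfold shiftDist
  calc ‖transL2 (u + v) p - toL2 p‖
      = ‖(transL2 (u + v) p - transL2 u p) + (transL2 u p - toL2 p)‖ := by congr 1; abel
    _ ≤ _ := norm_add_le _ _
    _ = _ := by rw [h]; ring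

lemma shiftDist_neg (p : AddMonoidAlgebra ℝ ℝ) (v : ℝ) : shiftDist p (-v) = shiftDist p v := by
  have h := norm_transL2_sub v (-v) 0 p
  rw [add_neg_cancel, add_zero, transL2_zero] at h
  rw [shiftDist, shiftDist, ← h, norm_sub_rev]

lemma shiftDist_nsmul (p : AddMonoidAlgebra ℝ ℝ) (k : ℕ) (v : ℝ) :
    shiftDist p (k * v) ≤ k * shiftDist p v := by
  induction k with
  | zero => simp [shiftDist_zero]
  | succ k ih =>
    have := shiftDist_add p (k * v) v
    push_cast
    rw [add_mul, add_mul, one_mul, one_mul]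
    linarith

lemma shiftDist_zsmul (p : AddMonoidAlgebra ℝ ℝ) (k : ℤ) (v : ℝ) :
    shiftDist p (k * v) ≤ |(k : ℝ)| * shiftDist p v := by
  obtain ⟨m, rfl | rfl⟩ := k.eq_nat_or_neg
  · simpa using shiftDist_nsmul p m v
  · have := shiftDist_nsmul p m v
    simpa [shiftDist_neg] using this

lemma shiftDist_sum {ι : Type*} (p : AddMonoidAlgebra ℝ ℝ) (S : Finset ι) (v : ι → ℝ) :
    shiftDist p (∑ i ∈ S, v i) ≤ ∑ i ∈ S, shiftDist p (v i) := by
  induction S using Finset.induction_on with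
  | empty => simp [shiftDist_zero]
  | insert a s ha ih =>
    rw [Finset.sum_insert ha, Finset.sum_insert ha]
    linarith [shiftDist_add p (v a) (∑ i ∈ s, v i)]

lemma transL2_lazyStep (μ b x : ℝ) (p : AddMonoidAlgebra ℝ ℝ) :
    transL2 x (lazyStep μ b * p) = (1 - μ) • transL2 x p + (μ / 2) • transL2 (x + b) p
      + (μ / 2) • transL2 (x - b) p := by
  have h : ∀ v r : ℝ, AddMonoidAlgebra.single x (1 : ℝ) * (AddMonoidAlgebra.single v r * p)
      = r • (AddMonoidAlgebra.single (x + v) (1 : ℝ) * p) := by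
    intro v r
    rw [← mul_assoc, AddMonoidAlgebra.single_mul_single, ← smul_mul_assoc,
      AddMonoidAlgebra.smul_single]
    simp
  simp only [transL2, lazyStep, add_mul, mul_add, h, map_add, map_smul, add_zero, sub_eq_add_neg]

lemma norm_sq_mix_le {E : Type*} [NormedAddCommGroup E] [InnerProductSpace ℝ E] {μ R : ℝ}
    (hμ0 : 0 ≤ μ) (hμ1 : μ ≤ 1) (x y z : E) (hx : ‖x‖ = R) (hy : ‖y‖ = R) (hz : ‖z‖ = R) :
    ‖(1 - μ) • x + (μ / 2) • y + (μ / 2) • z‖ ^ 2 ≤ R ^ 2 - μ / 4 * ‖y - z‖ ^ 2 := by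
  set u : E := (1 / 2 : ℝ) • (y + z) with hu
  have e : (1 - μ) • x + (μ / 2) • y + (μ / 2) • z = (1 - μ) • x + μ • u := by
    rw [hu]; module
  have hu2 : ‖u‖ ^ 2 = R ^ 2 - 1 / 4 * ‖y - z‖ ^ 2 := by
    have := parallelogram_law_with_norm ℝ y z
    rw [hu, norm_smul, Real.norm_of_nonneg (by norm_num)]
    rw [hy, hz] at this
    nlinarith
  have h1 : ‖(1 - μ) • x + μ • u‖ ≤ (1 - μ) * R + μ * ‖u‖ := by
    refine (norm_add_le _ _).trans ?_
    rw [norm_smul, norm_smul, Real.norm_of_nonneg (by linarith), Real.norm_of_nonneg hμ0, hx]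
  rw [e]
  have h0 := norm_nonneg ((1 - μ) • x + μ • u)
  calc ‖(1 - μ) • x + μ • u‖ ^ 2 ≤ ((1 - μ) * R + μ * ‖u‖) ^ 2 := by gcongr
    _ ≤ (1 - μ) * R ^ 2 + μ * ‖u‖ ^ 2 := by
      nlinarith [mul_nonneg (mul_nonneg hμ0 (sub_nonneg.2 hμ1)) (sq_nonneg (R - ‖u‖))]
    _ = _ := by rw [hu2]; ring

lemma norm_sq_lazyStep_mul_le {μ : ℝ} (hμ0 : 0 ≤ μ) (hμ1 : μ ≤ 1) (b : ℝ)
    (p : AddMonoidAlgebra ℝ ℝ) :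
    ‖toL2 (lazyStep μ b * p)‖ ^ 2 ≤ ‖toL2 p‖ ^ 2 - μ / 4 * shiftDist p (2 * b) ^ 2 := by
  have h := norm_sq_mix_le hμ0 hμ1 (transL2 0 p) (transL2 (0 + b) p) (transL2 (0 - b) p)
    (norm_transL2 _ _) (norm_transL2 _ _) (norm_transL2 _ _)
  rw [← transL2_lazyStep, transL2_zero] at h
  have h2 := norm_transL2_sub (-b) (2 * b) 0 p
  rw [show -b + 2 * b = 0 + b by ring, show -b + 0 = 0 - b by ring, transL2_zero] at h2
  rwa [h2] at h

lemma norm_toL2_lazyLaw_mul_le {μ : ℝ} (hμ0 : 0 ≤ μ) (hμ1 : μ ≤ 1) {n : ℕ} (b : Fin n → ℝ)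
    (U : Finset (Fin n)) (p : AddMonoidAlgebra ℝ ℝ) :
    ‖toL2 (lazyLaw μ b U * p)‖ ≤ ‖toL2 p‖ := by
  induction U using Finset.induction_on with
  | empty => simp [lazyLaw]
  | insert j U hj ih =>
    refine le_trans ?_ ih
    rw [lazyLaw, Finset.prod_insert hj, mul_assoc]
    refine (sq_le_sq₀ (norm_nonneg _) (norm_nonneg _)).1 ?_
    refine (norm_sq_lazyStep_mul_le hμ0 hμ1 (b j) _).trans ?_
    exact sub_le_self _ (by positivity)

lemma norm_toL2_lazyLaw_anti {μ : ℝ} (hμ0 : 0 ≤ μ) (hμ1 : μ ≤ 1) {n : ℕ} (b : Fin n → ℝ)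
    {S T : Finset (Fin n)} (h : S ⊆ T) :
    ‖toL2 (lazyLaw μ b T)‖ ≤ ‖toL2 (lazyLaw μ b S)‖ := by
  have := norm_toL2_lazyLaw_mul_le hμ0 hμ1 b (T \ S) (lazyLaw μ b S)
  rwa [lazyLaw, lazyLaw, Finset.prod_sdiff h] at this

lemma sum_mix_le {ι : Type*} (V : Finset ι) {μ : ℝ} (hμ0 : 0 ≤ μ) (hμ1 : μ ≤ 1)
    (f g h : ι → ℝ) (hf : ∑ v ∈ V, f v ≤ 1) (hg : ∑ v ∈ V, g v ≤ 1) (hh : ∑ v ∈ V, h v ≤ 1) :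
    ∑ v ∈ V, ((1 - μ) * f v + μ / 2 * g v + μ / 2 * h v) ≤ 1 := by
  rw [Finset.sum_add_distrib, Finset.sum_add_distrib, ← Finset.mul_sum, ← Finset.mul_sum,
    ← Finset.mul_sum]
  nlinarith

lemma sum_inner_lazyLaw_le {μ : ℝ} (hμ0 : 0 ≤ μ) (hμ1 : μ ≤ 1) {n : ℕ} (b : Fin n → ℝ)
    (S S' : Finset (Fin n)) (V : Finset ℝ) (x y : ℝ) :
    ∑ v ∈ V, inner ℝ (transL2 (v + x) (lazyLaw μ b S)) (transL2 y (lazyLaw μ b S')) ≤ 1 := by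
  induction S using Finset.induction_on generalizing x with
  | empty =>
    induction S' using Finset.induction_on generalizing y with
    | empty =>
      simp only [lazyLaw, Finset.prod_empty, transL2, mul_one, inner_toL2_single]
      have e : ∀ v : ℝ, v + x = y ↔ v = y - x := fun v => eq_sub_iff_add_eq.symm
      simp only [e]
      rw [Finset.sum_ite_eq']
      split_ifs <;> norm_num
    | insert j U hj ih =>
      have e : lazyLaw μ b (insert j U) = lazyStep μ (b j) * lazyLaw μ b U := by
        rw [lazyLaw, Finset.prod_insert hj]; rfl
      simp only [e, transL2_lazyStep, inner_add_right, inner_smul_right]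
      exact sum_mix_le V hμ0 hμ1 _ _ _ (ih _) (ih _) (ih _)
  | insert j U hj ih =>
    have e : lazyLaw μ b (insert j U) = lazyStep μ (b j) * lazyLaw μ b U := by
      rw [lazyLaw, Finset.prod_insert hj]; rfl
    simp only [e, transL2_lazyStep, inner_add_left, real_inner_smul_left]
    refine sum_mix_le V hμ0 hμ1 _ _ _ (ih _) ?_ ?_
    · simpa only [add_assoc] using ih (x + b j)
    · simpa only [add_sub_assoc] using ih (x - b j)

lemma lazyStep_eq_sum (μ b : ℝ) :
    lazyStep μ b = ∑ s : Fin 3, AddMonoidAlgebra.single (b * etaV s) (etaW μ s) := by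
  simp [lazyStep, Fin.sum_univ_three, etaV, etaW]
  abel

lemma lazyLaw_univ (μ : ℝ) {n : ℕ} (b : Fin n → ℝ) :
    lazyLaw μ b Finset.univ = ∑ s : Fin n → Fin 3,
      AddMonoidAlgebra.single (∑ j, b j * etaV (s j)) (∏ j, etaW μ (s j)) := by
  simp only [lazyLaw, lazyStep_eq_sum]
  rw [Finset.prod_univ_sum]
  simp only [AddMonoidAlgebra.prod_single, Fintype.piFinset_univ]

lemma probEta_linear_le_norm (μ : ℝ) {n : ℕ} (b : Fin n → ℝ) (a : ℝ) :
    probEta μ (fun y : Fin n → ℝ => ∑ j, b j * y j = a) ≤ ‖toL2 (lazyLaw μ b Finset.univ)‖ := by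
  have h : inner ℝ (toL2 (lazyLaw μ b Finset.univ)) (toL2 (AddMonoidAlgebra.single a 1)) =
      probEta μ (fun y : Fin n → ℝ => ∑ j, b j * y j = a) := by
    rw [lazyLaw_univ, map_sum, sum_inner]
    simp only [inner_toL2_single, probEta, mul_one, mul_ite, mul_zero]
    congr!
  rw [← h]
  refine (real_inner_le_norm _ _).trans ?_
  rw [norm_toL2_single_one, mul_one]

/-- If `∑ b j * y j` has an atom of mass at least `ρ`, then outside a small set of indices the
integer combinations of the `b j` with small coefficients take few values. -/
lemma exists_small_growth {μ δ ρ : ℝ} (hμ0 : 0 < μ) (hμ1 : μ ≤ 1) (hδ0 : 0 < δ) (hδ1 : δ ≤ 1)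
    (hρ : 0 < ρ) {n : ℕ} (b : Fin n → ℝ) (a : ℝ)
    (hb : ρ ≤ probEta μ (fun y : Fin n → ℝ => ∑ j, b j * y j = a)) :
    ∃ S : Finset (Fin n), ρ ^ 2 ≤ (1 - μ * δ / 2) ^ S.card ∧
      ∀ h : ℕ, 2 * δ * (h : ℝ) ^ 2 ≤ 1 → ∀ V : Finset ℝ,
        (∀ v ∈ V, ∃ c : Fin n → ℤ, (∀ j ∈ S, c j = 0) ∧ ∑ j, |c j| ≤ h ∧ v = ∑ j, c j * b j) →
        (V.card : ℝ) ≤ 2 / ρ ^ 2 := by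
  have hθ : 0 ≤ 1 - μ * δ / 2 := by nlinarith
  let G : Finset (Finset (Fin n)) := Finset.univ.filter fun S =>
    ‖toL2 (lazyLaw μ b S)‖ ^ 2 ≤ (1 - μ * δ / 2) ^ S.card
  have hG : G.Nonempty := by
    refine ⟨∅, ?_⟩
    have : toL2 (lazyLaw μ b ∅) = toL2 (AddMonoidAlgebra.single 0 1) := by
      simp [lazyLaw, AddMonoidAlgebra.one_def]
    simp [G, this, norm_toL2_single_one]
  obtain ⟨S, hSG, hmax⟩ := G.exists_max_image Finset.card hG
  have hS : ‖toL2 (lazyLaw μ b S)‖ ^ 2 ≤ (1 - μ * δ / 2) ^ S.card := by simpa [G] using hSG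
  set p := lazyLaw μ b S with hp
  have hρp : ρ ≤ ‖toL2 p‖ := (hb.trans (probEta_linear_le_norm μ b a)).trans
    (norm_toL2_lazyLaw_anti hμ0.le hμ1 b (Finset.subset_univ S))
  refine ⟨S, (pow_le_pow_left₀ hρ.le hρp 2).trans hS, ?_⟩
  have hgood : ∀ j, j ∉ S → shiftDist p (2 * b j) ^ 2 ≤ 2 * δ * ‖toL2 p‖ ^ 2 := by
    intro j hj
    by_contra hcon
    push Not at hcon
    have hins : insert j S ∈ G := by
      simp only [G, Finset.mem_filter, Finset.mem_univ, true_and, Finset.card_insert_of_notMem hj]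
      rw [lazyLaw, Finset.prod_insert hj]
      refine (norm_sq_lazyStep_mul_le hμ0.le hμ1 (b j) _).trans ?_
      change ‖toL2 p‖ ^ 2 - μ / 4 * shiftDist p (2 * b j) ^ 2 ≤ _
      rw [pow_succ (1 - μ * δ / 2)]
      have h1 := mul_le_mul_of_nonneg_right hS hθ
      nlinarith
    have := hmax _ hins
    rw [Finset.card_insert_of_notMem hj] at this
    omega
  intro h hh V hV
  have hν : ∀ j, j ∉ S → shiftDist p (2 * b j) ≤ √(2 * δ) * ‖toL2 p‖ := by
    intro j hj
    refine Real.le_sqrt_of_sq_le (hgood j hj) |>.trans ?_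
    rw [Real.sqrt_mul (by positivity), Real.sqrt_sq (norm_nonneg _)]
  have hhs : (h : ℝ) * √(2 * δ) ≤ 1 := by
    have : ((h : ℝ) * √(2 * δ)) ^ 2 ≤ 1 := by
      rw [mul_pow, Real.sq_sqrt (by positivity)]; linarith
    exact (sq_le_one_iff₀ (by positivity)).1 this
  have hcor : ∀ v ∈ V, ρ ^ 2 / 2 ≤ inner ℝ (transL2 (2 * v) p) (toL2 p) := by
    intro v hv
    obtain ⟨c, hc0, hc, rfl⟩ := hV v hv
    have h1 : shiftDist p (2 * ∑ j, c j * b j) ≤ ‖toL2 p‖ := by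
      have e : 2 * ∑ j, (c j : ℝ) * b j = ∑ j, (c j : ℝ) * (2 * b j) := by
        rw [Finset.mul_sum]; refine Finset.sum_congr rfl fun j _ => by ring
      rw [e]
      calc _ ≤ ∑ j, shiftDist p ((c j : ℝ) * (2 * b j)) := shiftDist_sum _ _ _
        _ ≤ ∑ j, |(c j : ℝ)| * (√(2 * δ) * ‖toL2 p‖) := by
          refine Finset.sum_le_sum fun j _ => ?_
          by_cases hj : j ∈ S
          · simp [hc0 j hj, shiftDist_zero]
          · exact (shiftDist_zsmul _ _ _).trans
              (mul_le_mul_of_nonneg_left (hν j hj) (abs_nonneg _))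
        _ = (∑ j, |(c j : ℝ)|) * (√(2 * δ) * ‖toL2 p‖) := by rw [Finset.sum_mul]
        _ ≤ h * (√(2 * δ) * ‖toL2 p‖) := by
          refine mul_le_mul_of_nonneg_right ?_ (by positivity)
          exact_mod_cast hc
        _ = (h * √(2 * δ)) * ‖toL2 p‖ := by ring
        _ ≤ 1 * ‖toL2 p‖ := by gcongr
        _ = _ := one_mul _
    set v := ∑ j, (c j : ℝ) * b j
    have h2 : shiftDist p (2 * v) ^ 2 =
        2 * ‖toL2 p‖ ^ 2 - 2 * inner ℝ (transL2 (2 * v) p) (toL2 p) := by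
      rw [shiftDist, norm_sub_sq_real, norm_transL2]; ring
    have h3 : shiftDist p (2 * v) ^ 2 ≤ ‖toL2 p‖ ^ 2 :=
      pow_le_pow_left₀ (norm_nonneg _) h1 2
    have h4 := pow_le_pow_left₀ hρ.le hρp 2
    linarith
  have hsum := sum_inner_lazyLaw_le hμ0.le hμ1 b S S (V.image fun v => 2 * v) 0 0
  rw [Finset.sum_image (fun x _ y _ hxy => by simpa using hxy)] at hsum
  simp only [add_zero, transL2_zero] at hsum
  have := (Finset.card_nsmul_le_sum V _ _ hcor).trans hsum
  rw [nsmul_eq_mul] at this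
  rw [le_div_iff₀ (by positivity)]
  linarith

/-- Integer combinations of the `b j`, `j ∉ S`, of total weight at most `h`, take at most `B`
values. -/
def GrowthLE {n : ℕ} (b : Fin n → ℝ) (S : Finset (Fin n)) (h B : ℕ) : Prop :=
  ∀ V : Finset ℝ,
    (∀ v ∈ V, ∃ c : Fin n → ℤ, (∀ j ∈ S, c j = 0) ∧ ∑ j, |c j| ≤ h ∧ v = ∑ j, c j * b j) →
    V.card ≤ B

/-- There is no nontrivial relation among the `b i`, `i ∈ I`, with integer coefficients of
absolute value at most `M`. -/
def Dissoc {n : ℕ} (b : Fin n → ℝ) (I : Finset (Fin n)) (M : ℕ) : Prop :=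
  ∀ c : Fin n → ℤ, (∀ i, i ∉ I → c i = 0) → (∀ i, |c i| ≤ M) → ∑ i, (c i : ℝ) * b i = 0 → c = 0

lemma Dissoc.mono {n : ℕ} {b : Fin n → ℝ} {I : Finset (Fin n)} {M M' : ℕ} (h : Dissoc b I M')
    (hM : M ≤ M') : Dissoc b I M := fun c hc hcM => h c hc fun i => (hcM i).trans (by exact_mod_cast hM)

lemma Dissoc.pow_card_le {n : ℕ} {b : Fin n → ℝ} {I S : Finset (Fin n)} {h B q : ℕ}
    (hI : Dissoc b I q) (hg : GrowthLE b S h B) (hIS : Disjoint I S) (hh : I.card * q ≤ h) :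
    q ^ I.card ≤ B := by
  let P : Finset (Fin n → ℤ) := Fintype.piFinset fun i => if i ∈ I then Finset.Ico 0 (q : ℤ) else {0}
  have hP : ∀ c ∈ P, (∀ i, i ∉ I → c i = 0) ∧ ∀ i ∈ I, 0 ≤ c i ∧ c i < q := by
    intro c hc
    rw [Fintype.mem_piFinset] at hc
    refine ⟨fun i hi => ?_, fun i hi => ?_⟩ <;> simpa [hi] using hc i
  have hcard : P.card = q ^ I.card := by
    rw [Fintype.card_piFinset, ← Finset.prod_const]
    rw [← Finset.prod_subset (Finset.subset_univ I)]
    · exact Finset.prod_congr rfl fun i hi => by simp [hi]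
    · intro i _ hi; simp [hi]
  have hinj : Set.InjOn (fun c : Fin n → ℤ => ∑ i, (c i : ℝ) * b i) P := by
    intro c hc c' hc' hcc
    have h1 := hP c hc
    have h2 := hP c' hc'
    refine sub_eq_zero.1 (hI (c - c') (fun i hi => ?_) (fun i => ?_) ?_)
    · simp [h1.1 i hi, h2.1 i hi]
    · by_cases hi : i ∈ I
      · have := h1.2 i hi
        have := h2.2 i hi
        rw [Pi.sub_apply, abs_le]; constructor <;> omega
      · simp [h1.1 i hi, h2.1 i hi]
    · simp only [Pi.sub_apply, Int.cast_sub, sub_mul, Finset.sum_sub_distrib]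
      exact sub_eq_zero.2 hcc
  rw [← hcard, ← Finset.card_image_of_injOn hinj]
  refine hg _ fun v hv => ?_
  obtain ⟨c, hc, rfl⟩ := Finset.mem_image.1 hv
  have h1 := hP c hc
  refine ⟨c, fun j hj => h1.1 j fun hjI => Finset.disjoint_left.1 hIS hjI hj, ?_, rfl⟩
  rw [← Finset.sum_subset (Finset.subset_univ I) fun i _ hi => by simp [h1.1 i hi]]
  calc ∑ i ∈ I, |c i| ≤ ∑ _i ∈ I, (q : ℤ) := Finset.sum_le_sum fun i hi => by
        have := h1.2 i hi
        rw [abs_of_nonneg this.1]; exact this.2.le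
    _ ≤ h := by simpa using by exact_mod_cast hh

lemma exists_relation {n : ℕ} {b : Fin n → ℝ} {I S : Finset (Fin n)} {m M : ℕ} (hm : 1 ≤ m)
    (hmM : m ≤ M) (hI : Dissoc b I M) (hIS : Disjoint I S)
    (hmax : ∀ I' : Finset (Fin n), Disjoint I' S → I'.card = I.card + 1 → ¬ Dissoc b I' m)
    (i : Fin n) (hi : i ∉ S) :
    ∃ (d : ℕ) (z : Fin n → ℤ), 1 ≤ d ∧ d ≤ m ∧ (∀ j, j ∉ I → z j = 0) ∧ (∀ j, |z j| ≤ m) ∧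
      (d : ℝ) * b i = ∑ j, (z j : ℝ) * b j := by
  by_cases hiI : i ∈ I
  · refine ⟨1, Pi.single i 1, le_rfl, hm, fun j hj => ?_, fun j => ?_, ?_⟩
    · rw [Pi.single_eq_of_ne]; rintro rfl; exact hj hiI
    · by_cases h : j = i
      · subst h; simpa using hm
      · simp [h]
    · rw [Finset.sum_eq_single i]
      · simp
      · intro j _ h; simp [h]
      · simp
  have hnd := hmax (insert i I) (Finset.disjoint_insert_left.2 ⟨hi, hIS⟩)
    (Finset.card_insert_of_notMem hiI)
  have key : ∃ c : Fin n → ℤ, (∀ j, j ∉ insert i I → c j = 0) ∧ (∀ j, |c j| ≤ m) ∧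
      ∑ j, (c j : ℝ) * b j = 0 ∧ 0 < c i := by
    unfold Dissoc at hnd
    push Not at hnd
    obtain ⟨c, hc, hcm, hsum, hc0⟩ := hnd
    rcases lt_trichotomy (c i) 0 with h | h | h
    · refine ⟨-c, fun j hj => by simp [hc j hj], fun j => by simpa using hcm j, ?_, by simpa using h⟩
      simpa using hsum
    · refine absurd (hI.mono hmM c (fun j hj => ?_) hcm hsum) hc0
      by_cases hji : j = i
      · rw [hji, h]
      · exact hc j (by simp [hji, hj])
    · exact ⟨c, hc, hcm, hsum, h⟩
  obtain ⟨c, hc, hcm, hsum, hci⟩ := key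
  refine ⟨(c i).toNat, fun j => if j = i then 0 else - c j, by omega, ?_, fun j hj => ?_,
    fun j => ?_, ?_⟩
  · have := hcm i; rw [abs_of_pos hci] at this; omega
  · by_cases hji : j = i
    · simp [hji]
    · simp [hji, hc j (by simp [hji, hj])]
  · dsimp only
    split_ifs
    · simp
    · simpa using hcm j
  · have e : ((c i).toNat : ℝ) = c i := by
      have : ((c i).toNat : ℤ) = c i := Int.toNat_of_nonneg hci.le
      exact_mod_cast this
    rw [e]
    rw [← Finset.add_sum_erase _ _ (Finset.mem_univ i)] at hsum ⊢
    simp only [if_true, Int.cast_zero, zero_mul, zero_add]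
    rw [Finset.sum_congr rfl (g := fun j => - ((c j : ℝ) * b j)), Finset.sum_neg_distrib]
    · linarith
    · intro j hj
      simp [Finset.ne_of_mem_erase hj]

/-- Integer vectors supported on `I`. -/
def IntVec {n : ℕ} (I : Finset (Fin n)) (x : Fin n → ℚ) : Prop :=
  ∃ z : Fin n → ℤ, (∀ j, j ∉ I → z j = 0) ∧ ∀ j, x j = z j

lemma IntVec.add {n : ℕ} {I : Finset (Fin n)} {x y : Fin n → ℚ} (hx : IntVec I x)
    (hy : IntVec I y) : IntVec I (x + y) := by
  obtain ⟨z, hz, hxz⟩ := hx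
  obtain ⟨w, hw, hyw⟩ := hy
  exact ⟨z + w, fun j hj => by simp [hz j hj, hw j hj], fun j => by simp [hxz, hyw]⟩

lemma IntVec.zsmul {n : ℕ} {I : Finset (Fin n)} {x : Fin n → ℚ} (hx : IntVec I x)
    (t : ℤ) : IntVec I (t • x) := by
  obtain ⟨z, hz, hxz⟩ := hx
  exact ⟨t • z, fun j hj => by simp [hz j hj], fun j => by simp [hxz]⟩

lemma IntVec.nsmul {n : ℕ} {I : Finset (Fin n)} {x : Fin n → ℚ} (hx : IntVec I x)
    (t : ℕ) : IntVec I (t • x) := by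
  simpa using hx.zsmul t

/-- The subgroup of integer vectors supported on `I`. -/
def intLattice {n : ℕ} (I : Finset (Fin n)) : AddSubgroup (Fin n → ℚ) where
  carrier := {x | IntVec I x}
  add_mem' hx hy := IntVec.add hx hy
  zero_mem' := ⟨0, by simp, by simp⟩
  neg_mem' hx := by simpa using IntVec.zsmul hx (-1)

/-- `u i` records the coordinates of `b i` with respect to the family `b j`, `j ∈ I`, with
numerators and denominators at most `m`. -/
def IsCoord {n : ℕ} (b : Fin n → ℝ) (I S : Finset (Fin n)) (m : ℕ) (u : Fin n → Fin n → ℚ) :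
    Prop :=
  ∀ i, i ∉ S → (∃ d : ℕ, 1 ≤ d ∧ d ≤ m ∧ IntVec I (d • u i)) ∧ (∀ j, |u i j| ≤ m) ∧
    ∑ j, (u i j : ℝ) * b j = b i

lemma card_le_of_growth {n : ℕ} {b : Fin n → ℝ} {I S : Finset (Fin n)} {h Bd m M N w : ℕ}
    {u : Fin n → Fin n → ℚ} (hg : GrowthLE b S h Bd) (hI : Dissoc b I M)
    (hu : IsCoord b I S m u) (B : Finset (Fin n → ℚ)) (Λ : AddSubgroup (Fin n → ℚ)) (hN : 1 ≤ N)
    (hΛ : ∀ x ∈ Λ, IntVec I (N • x)) (hwh : w ≤ h) (hM : N * (2 * w * m) ≤ M)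
    (hB : ∀ β ∈ B, β ∈ Λ ∧ ∃ c : Fin n → ℤ, (∀ j ∈ S, c j = 0) ∧ ∑ j, |c j| ≤ w ∧
      β = ∑ j, c j • u j) : B.card ≤ Bd := by
  have hbound : ∀ β ∈ B, ∀ j, |β j| ≤ w * m := by
    intro β hβ j
    obtain ⟨-, c, hc0, hc, rfl⟩ := hB β hβ
    rw [Finset.sum_apply]
    calc |∑ i, (c i • u i) j| ≤ ∑ i, |(c i • u i) j| := Finset.abs_sum_le_sum_abs _ _
      _ ≤ ∑ i, |(c i : ℚ)| * m := by
        refine Finset.sum_le_sum fun i _ => ?_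
        by_cases hi : i ∈ S
        · simp [hc0 i hi]
        · simp only [Pi.smul_apply, zsmul_eq_mul, abs_mul]
          exact mul_le_mul_of_nonneg_left ((hu i hi).2.1 j) (abs_nonneg _)
      _ = (∑ i, |(c i : ℚ)|) * m := by rw [Finset.sum_mul]
      _ ≤ w * m := by
        refine mul_le_mul_of_nonneg_right ?_ (Nat.cast_nonneg _)
        exact_mod_cast hc
  have hinj : Set.InjOn (fun β : Fin n → ℚ => ∑ j, (β j : ℝ) * b j) B := by
    intro β hβ β' hβ' hbb
    obtain ⟨z, hz0, hz⟩ := hΛ _ (sub_mem (hB β hβ).1 (hB β' hβ').1)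
    have hz1 : z = 0 := by
      refine hI z hz0 (fun j => ?_) ?_
      · have h1 : |(z j : ℚ)| ≤ N * (2 * w * m) := by
          rw [← hz j, Pi.smul_apply, nsmul_eq_mul, abs_mul, Nat.abs_cast]
          refine mul_le_mul_of_nonneg_left ?_ (Nat.cast_nonneg _)
          rw [Pi.sub_apply]
          have := abs_sub (β j) (β' j)
          linarith [hbound β hβ j, hbound β' hβ' j]
        have h2 : |z j| ≤ ((N * (2 * w * m) : ℕ) : ℤ) := by exact_mod_cast h1
        exact h2.trans (by exact_mod_cast hM)
      · have h1 : ∀ j, (z j : ℝ) = N * ((β j : ℝ) - β' j) := by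
          intro j
          have := hz j
          rw [Pi.smul_apply, nsmul_eq_mul, Pi.sub_apply] at this
          exact_mod_cast this.symm
        simp only [h1, mul_assoc, sub_mul, ← Finset.mul_sum, Finset.sum_sub_distrib]
        rw [show ∑ j, (β j : ℝ) * b j = ∑ j, (β' j : ℝ) * b j from hbb]
        simp
    funext j
    have := hz j
    rw [hz1, Pi.smul_apply, nsmul_eq_mul, Pi.sub_apply] at this
    have hN' : (N : ℚ) ≠ 0 := by positivity
    simpa [hN', sub_eq_zero] using this
  rw [← Finset.card_image_of_injOn hinj]
  refine hg _ fun v hv => ?_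
  obtain ⟨β, hβ, rfl⟩ := Finset.mem_image.1 hv
  obtain ⟨-, c, hc0, hc, rfl⟩ := hB β hβ
  refine ⟨c, hc0, hc.trans (by exact_mod_cast hwh), ?_⟩
  have h1 : ∀ i, (c i : ℝ) * b i = ∑ j, (c i : ℝ) * (u i j : ℝ) * b j := by
    intro i
    by_cases hi : i ∈ S
    · simp [hc0 i hi]
    · rw [← (hu i hi).2.2, Finset.mul_sum]
      simp only [mul_assoc]
  simp only [h1]
  rw [Finset.sum_comm]
  refine Finset.sum_congr rfl fun j _ => ?_
  rw [← Finset.sum_mul]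
  congr 1
  simp [Finset.sum_apply]

lemma exists_order {n : ℕ} {I : Finset (Fin n)} {Λ : AddSubgroup (Fin n → ℚ)}
    (hΛ : ∀ x, IntVec I x → x ∈ Λ) {m : ℕ} {x : Fin n → ℚ} (hx : x ∉ Λ)
    (hd : ∃ d : ℕ, 1 ≤ d ∧ d ≤ m ∧ IntVec I (d • x)) :
    ∃ j : ℕ, 2 ≤ j ∧ j ≤ m ∧ j • x ∈ Λ ∧ ∀ t : ℤ, t • x ∈ Λ → |t| < j → t = 0 := by
  have hex : ∃ d : ℕ, 1 ≤ d ∧ d • x ∈ Λ := by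
    obtain ⟨d, h1, -, h2⟩ := hd
    exact ⟨d, h1, hΛ _ h2⟩
  have hspec := Nat.find_spec hex
  refine ⟨Nat.find hex, ?_, ?_, hspec.2, ?_⟩
  · rcases Nat.lt_or_ge 1 (Nat.find hex) with h | h
    · exact h
    · have h1 : Nat.find hex = 1 := le_antisymm h hspec.1
      rw [h1, one_smul] at hspec
      exact absurd hspec.2 hx
  · obtain ⟨d, h1, h2, h3⟩ := hd
    exact (Nat.find_min' hex ⟨h1, hΛ _ h3⟩).trans h2
  · intro t ht htj
    by_contra ht0
    rw [Int.abs_eq_natAbs] at htj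
    refine Nat.find_min hex (m := t.natAbs) (by omega) ⟨by omega, ?_⟩
    rw [← natCast_zsmul]
    rcases abs_choice t with h | h
    · rwa [Int.natCast_natAbs, h]
    · rw [Int.natCast_natAbs, h, neg_smul]; exact neg_mem ht

/-- The state of the construction of a common denominator after `l` steps. -/
structure DenomState {n : ℕ} (I S : Finset (Fin n)) (u : Fin n → Fin n → ℚ) (q R Bd l : ℕ) where
  /-- the lattice generated so far -/
  Λ : AddSubgroup (Fin n → ℚ)
  /-- a denominator of the lattice -/
  N : ℕ
  /-- distinct small combinations of the `u i` in the lattice -/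
  B : Finset (Fin n → ℚ)
  intVec_mem : ∀ x, IntVec I x → x ∈ Λ
  one_le_N : 1 ≤ N
  smul_intVec : ∀ x ∈ Λ, IntVec I (N • x)
  mem_B : ∀ β ∈ B, β ∈ Λ ∧ ∃ c : Fin n → ℤ, (∀ j ∈ S, c j = 0) ∧ ∑ j, |c j| ≤ ((l * q : ℕ) : ℤ) ∧
      β = ∑ j, c j • u j
  two_pow_le : 2 ^ l ≤ B.card
  N_le : N ≤ B.card ^ R
  card_le : B.card ≤ Bd

lemma exists_comb_add_nsmul {n : ℕ} {S : Finset (Fin n)} (u : Fin n → Fin n → ℚ) {i : Fin n}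
    (hi : i ∉ S) {c : Fin n → ℤ} {w w' t : ℕ} (hc0 : ∀ j ∈ S, c j = 0) (hc : ∑ j, |c j| ≤ w)
    (hw : w + t ≤ w') :
    ∃ c' : Fin n → ℤ, (∀ j ∈ S, c' j = 0) ∧ ∑ j, |c' j| ≤ w' ∧
      ∑ j, c j • u j + t • u i = ∑ j, c' j • u j := by
  have hne : ∀ j ∈ S, j ≠ i := by
    rintro j hj rfl; exact hi hj
  obtain ⟨e, he, hei⟩ : ∃ e : Fin n → ℤ, (∀ j, j ≠ i → e j = 0) ∧ e i = t :=
    ⟨fun j => if j = i then t else 0, fun j hj => by simp [hj], by simp⟩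
  have hs1 : ∑ j, |e j| = t := by
    rw [Finset.sum_eq_single i (fun j _ hj => by simp [he j hj]) (by simp), hei, Nat.abs_cast]
  have hs2 : ∑ j, e j • u j = t • u i := by
    rw [Finset.sum_eq_single i (fun j _ hj => by simp [he j hj]) (by simp), hei, natCast_zsmul]
  refine ⟨c + e, fun j hj => by simp [hc0 j hj, he j (hne j hj)], ?_, ?_⟩
  · have h1 : ∑ j, |(c + e) j| ≤ ∑ j, (|c j| + |e j|) :=
      Finset.sum_le_sum fun j _ => abs_add_le _ _
    rw [Finset.sum_add_distrib, hs1] at h1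
    have : (w : ℤ) + t ≤ w' := by exact_mod_cast hw
    linarith
  · simp only [Pi.add_apply, add_smul, Finset.sum_add_distrib]
    rw [hs2]

lemma nsmul_add_zsmul_eq {G : Type*} [AddCommGroup G] (j N : ℕ) (t : ℤ) (x y : G) :
    (j * N) • (y + t • x) = j • (N • y) + t • (N • (j • x)) := by
  module

lemma exists_common_denom {n : ℕ} {b : Fin n → ℝ} {I S : Finset (Fin n)} {h Bd m M q R L : ℕ}
    {u : Fin n → Fin n → ℚ} (hg : GrowthLE b S h Bd) (hI : Dissoc b I M)
    (hu : IsCoord b I S m u) (hq : 2 ≤ q) (hmq : m ≤ q ^ R) (hL : Bd < 2 ^ L) (hLh : L * q ≤ h)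
    (hM : m * Bd ^ R * (2 * (L * q) * m) ≤ M) :
    ∃ N : ℕ, 1 ≤ N ∧ N ≤ Bd ^ R ∧ ∀ i, i ∉ S → IntVec I (N • u i) := by
  by_contra hcon
  push Not at hcon
  have hBd : 1 ≤ Bd := by
    refine le_trans ?_ (hg {0} fun v hv => ⟨0, by simp, by simp, by simpa using hv⟩)
    simp
  have hlt : ∀ l, DenomState I S u q R Bd l → l < L := fun l s =>
    (Nat.pow_lt_pow_iff_right (by norm_num : 1 < 2)).1
      ((s.two_pow_le.trans s.card_le).trans_lt hL)
  have hstate : ∀ l, Nonempty (DenomState I S u q R Bd l) := by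
    intro l
    induction l with
    | zero =>
      refine ⟨⟨intLattice I, 1, {0}, fun x hx => hx, le_rfl, fun x hx => by rwa [one_smul], ?_,
        by simp, by simp, by simpa using hBd⟩⟩
      intro β hβ
      rw [Finset.mem_singleton] at hβ
      subst hβ
      exact ⟨zero_mem _, 0, by simp, by simp, by simp⟩
    | succ l ih =>
      obtain ⟨s⟩ := ih
      obtain ⟨i, hiS, hi⟩ := hcon s.N s.one_le_N
        (s.N_le.trans (Nat.pow_le_pow_left s.card_le R))
      have hiΛ : u i ∉ s.Λ := fun hmem => hi (s.smul_intVec _ hmem)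
      obtain ⟨j, hj2, hjm, hjΛ, hjmin⟩ := exists_order s.intVec_mem hiΛ (hu i hiS).1
      let B' : Finset (Fin n → ℚ) :=
        (s.B ×ˢ Finset.range (min j q)).image fun x => x.1 + x.2 • u i
      let Λ' : AddSubgroup (Fin n → ℚ) := s.Λ ⊔ AddSubgroup.zmultiples (u i)
      have hle : s.Λ ≤ Λ' := le_sup_left
      have hui : u i ∈ Λ' :=
        (le_sup_right : _ ≤ Λ') (AddSubgroup.mem_zmultiples _)
      have hcard : B'.card = s.B.card * min j q := by
        rw [Finset.card_image_of_injOn, Finset.card_product, Finset.card_range]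
        rintro ⟨β, c⟩ hβ ⟨β', c'⟩ hβ' heq
        simp only [Finset.coe_product, Set.mem_prod, Finset.mem_coe, Finset.mem_range] at hβ hβ'
        simp only at heq
        have hmem : ((c : ℤ) - c') • u i ∈ s.Λ := by
          have e : ((c : ℤ) - c') • u i = β' - β := by
            rw [sub_smul, natCast_zsmul, natCast_zsmul]
            linear_combination heq
          rw [e]
          exact sub_mem (s.mem_B _ hβ'.1).1 (s.mem_B _ hβ.1).1
        have hc := hjmin _ hmem (by rw [abs_lt]; omega)
        have hcc : c = c' := by omega
        subst hcc
        simpa using heq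
      have hB' : ∀ β ∈ B', β ∈ Λ' ∧ ∃ c : Fin n → ℤ, (∀ j ∈ S, c j = 0) ∧
          ∑ j, |c j| ≤ (((l + 1) * q : ℕ) : ℤ) ∧ β = ∑ j, c j • u j := by
        intro β hβ
        obtain ⟨⟨γ, t⟩, hγ, rfl⟩ := Finset.mem_image.1 hβ
        rw [Finset.mem_product, Finset.mem_range] at hγ
        obtain ⟨h1, c, hc0, hc, hγc⟩ := s.mem_B γ hγ.1
        have htq : t < q := hγ.2.trans_le (min_le_right _ _)
        refine ⟨add_mem (hle h1) (nsmul_mem hui _), ?_⟩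
        rw [hγc]
        exact exists_comb_add_nsmul u hiS hc0 hc (by rw [add_mul, one_mul]; omega)
      have hΛ' : ∀ x ∈ Λ', IntVec I ((j * s.N) • x) := by
        intro x hx
        obtain ⟨y, hy, z, hz, rfl⟩ := AddSubgroup.mem_sup.1 hx
        obtain ⟨t, rfl⟩ := AddSubgroup.mem_zmultiples_iff.1 hz
        rw [nsmul_add_zsmul_eq]
        exact ((s.smul_intVec y hy).nsmul j).add ((s.smul_intVec _ hjΛ).zsmul t)
      have hmin2 : 2 ≤ min j q := le_min hj2 hq
      have hL1 : l + 1 ≤ L := hlt l s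
      have hjR : j ≤ min j q ^ R := by
        rcases le_total j q with hjq | hjq
        · rw [min_eq_left hjq]
          rcases Nat.eq_zero_or_pos R with hR | hR
          · subst hR; rw [pow_zero] at hmq; omega
          · exact Nat.le_self_pow hR.ne' j
        · rw [min_eq_right hjq]; exact hjm.trans hmq
      refine ⟨⟨Λ', j * s.N, B', fun x hx => hle (s.intVec_mem x hx),
        Nat.mul_pos (by omega) s.one_le_N, hΛ', hB', ?_, ?_, ?_⟩⟩
      · rw [hcard, pow_succ]
        exact Nat.mul_le_mul s.two_pow_le hmin2
      · rw [hcard, mul_pow, mul_comm]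
        exact Nat.mul_le_mul s.N_le hjR
      · refine card_le_of_growth hg hI hu B' Λ' (Nat.mul_pos (by omega) s.one_le_N) hΛ'
          ((Nat.mul_le_mul_right q hL1).trans hLh) (le_trans ?_ hM) hB'
        refine Nat.mul_le_mul (Nat.mul_le_mul hjm ?_) ?_
        · exact s.N_le.trans (Nat.pow_le_pow_left s.card_le R)
        · exact Nat.mul_le_mul_right m (Nat.mul_le_mul_left 2 (Nat.mul_le_mul_right q hL1))
  exact lt_irrefl L (hlt L (hstate L).some)

/-- Exponents of the scales used for dissociation. -/
def scaleExp (D : ℕ) : ℕ → ℕ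
  | 0 => 1
  | s + 1 => (D + 2) * scaleExp D s + 3

lemma scaleExp_mono (D : ℕ) : Monotone (scaleExp D) :=
  monotone_nat_of_le_succ fun s => by rw [scaleExp]; nlinarith

lemma exists_isCoord {n : ℕ} {b : Fin n → ℝ} {I S : Finset (Fin n)} {m M : ℕ} (hm : 1 ≤ m)
    (hmM : m ≤ M) (hI : Dissoc b I M) (hIS : Disjoint I S)
    (hmax : ∀ I' : Finset (Fin n), Disjoint I' S → I'.card = I.card + 1 → ¬ Dissoc b I' m) :
    ∃ u, IsCoord b I S m u := by
  choose! d z hd1 hdm hz hzm hdz using exists_relation hm hmM hI hIS hmax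
  refine ⟨fun i j => z i j / d i, fun i hi => ⟨⟨d i, hd1 i hi, hdm i hi, z i, hz i hi, ?_⟩, ?_, ?_⟩⟩
  · intro j
    have : (d i : ℚ) ≠ 0 := by have := hd1 i hi; positivity
    simp only [Pi.smul_apply, nsmul_eq_mul]
    field_simp
  · intro j
    have h1 : (1 : ℚ) ≤ d i := by exact_mod_cast hd1 i hi
    rw [abs_div, Nat.abs_cast]
    refine (div_le_self (abs_nonneg _) h1).trans ?_
    exact_mod_cast hzm i hi j
  · have : (d i : ℝ) ≠ 0 := by have := hd1 i hi; positivity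
    push_cast
    rw [← mul_right_inj' this, hdz i hi, Finset.mul_sum]
    refine Finset.sum_congr rfl fun j _ => ?_
    field_simp

/-- Slow growth forces all the `b i`, `i ∉ S`, to be combinations of boundedly many of them, with
a common denominator and coefficients of polynomial size. -/
lemma exists_basis_of_growth (D : ℕ) : ∃ K : ℕ, ∀ q L h Bd : ℕ, 2 ≤ q → L ≤ q → L * q ≤ h →
    D * q ≤ h → Bd < q ^ D → Bd < 2 ^ L → ∀ (n : ℕ) (b : Fin n → ℝ) (S : Finset (Fin n)),
    GrowthLE b S h Bd → ∃ (I : Finset (Fin n)) (N : ℕ), I.card ≤ D ∧ 1 ≤ N ∧ N ≤ q ^ K ∧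
      ∀ i, i ∉ S → ∃ z : Fin n → ℤ, (∀ j, j ∉ I → z j = 0) ∧ (∀ j, |z j| ≤ q ^ K) ∧
        (N : ℝ) * b i = ∑ j, (z j : ℝ) * b j := by
  refine ⟨(D + 1) * scaleExp D D, fun q L h Bd hq hLq hLh hDh hBq hBL n b S hg => ?_⟩
  have hq1 : 1 ≤ q := by omega
  let f : ℕ → ℕ := fun t => q ^ scaleExp D (D - t)
  let P : ℕ → Prop := fun t => ∃ I : Finset (Fin n), Disjoint I S ∧ I.card = t ∧ Dissoc b I (f t)
  have hP0 : P 0 := by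
    refine ⟨∅, by simp, by simp, fun c hc _ _ => ?_⟩
    funext i
    exact hc i (by simp)
  have hPD : ¬ P D := by
    rintro ⟨I, hIS, hcard, hI⟩
    have : f D = q := by simp [f, scaleExp]
    rw [this] at hI
    have := hI.pow_card_le hg hIS (by rwa [hcard])
    rw [hcard] at this
    omega
  obtain ⟨d, hdD, ⟨I, hIS, hcard, hI⟩, hnot⟩ : ∃ d, d < D ∧ P d ∧ ¬ P (d + 1) := by
    by_contra hcon
    push Not at hcon
    have : ∀ t, t ≤ D → P t := by
      intro t
      induction t with
      | zero => exact fun _ => hP0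
      | succ t ih => exact fun ht => hcon t (by omega) (ih (by omega))
    exact hPD (this D le_rfl)
  obtain ⟨s, hs⟩ : ∃ s, D - d = s + 1 := ⟨D - d - 1, by omega⟩
  have hs' : D - (d + 1) = s := by omega
  set R := scaleExp D s with hR
  have hRD : R ≤ scaleExp D D := scaleExp_mono D (by omega)
  have hM : f d = q ^ ((D + 2) * R + 3) := by simp only [f, hs, scaleExp, hR]
  have hm : f (d + 1) = q ^ R := by simp only [f, hs', hR]
  have hmM : q ^ R ≤ q ^ ((D + 2) * R + 3) := Nat.pow_le_pow_right hq1 (by nlinarith)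
  rw [hM] at hI
  obtain ⟨u, hu⟩ := exists_isCoord (Nat.one_le_pow _ _ hq1) hmM hI hIS
    (fun I' hI' hc hdis => hnot ⟨I', hI', by rw [hc, hcard], by rwa [hm]⟩)
  have hBR : Bd ^ R ≤ q ^ (D * R) := by
    rw [pow_mul]; exact Nat.pow_le_pow_left hBq.le R
  obtain ⟨N, hN1, hNB, hN⟩ := exists_common_denom hg hI hu hq le_rfl hBL hLh (by
    calc q ^ R * Bd ^ R * (2 * (L * q) * q ^ R)
        ≤ q ^ R * q ^ (D * R) * (q * (q * q) * q ^ R) := by gcongr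
      _ = q ^ ((D + 2) * R + 3) := by ring)
  refine ⟨I, N, by omega, hN1, ?_, fun i hi => ?_⟩
  · refine (hNB.trans hBR).trans (Nat.pow_le_pow_right hq1 ?_)
    exact Nat.mul_le_mul (by omega) hRD
  · obtain ⟨z, hz, hzu⟩ := hN i hi
    obtain ⟨-, hum, hub⟩ := hu i hi
    have hzu' : ∀ j, (z j : ℚ) = N * u i j := fun j => by
      rw [← hzu j, Pi.smul_apply, nsmul_eq_mul]
    refine ⟨z, hz, fun j => ?_, ?_⟩
    · have h1 : |(z j : ℚ)| ≤ N * (q ^ R : ℕ) := by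
        rw [hzu', abs_mul, Nat.abs_cast]
        exact mul_le_mul_of_nonneg_left (hum j) (Nat.cast_nonneg _)
      have h2 : |z j| ≤ ((N * q ^ R : ℕ) : ℤ) := by exact_mod_cast h1
      refine h2.trans ?_
      have : N * q ^ R ≤ q ^ ((D + 1) * scaleExp D D) :=
        calc N * q ^ R ≤ q ^ (D * R) * q ^ R := Nat.mul_le_mul_right _ (hNB.trans hBR)
          _ = q ^ ((D + 1) * R) := by ring
          _ ≤ _ := Nat.pow_le_pow_right hq1 (Nat.mul_le_mul_left _ hRD)
      exact_mod_cast this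
    · have hzr : ∀ j, (z j : ℝ) = N * (u i j : ℝ) := fun j => by exact_mod_cast hzu' j
      rw [← hub, Finset.mul_sum]
      exact Finset.sum_congr rfl fun j _ => by rw [hzr, mul_assoc]

/-- A symmetric GAP is contained in a proper one of no larger rank and comparable size. -/
lemma exists_proper_gap (r : ℕ) : ∀ (N : ℕ) (g : Fin r → ℝ), 1 ≤ N →
    ∃ Q : Set ℝ, IsProperSymGAPSet Q r (((4 * N) ^ (r * 2 ^ r) : ℕ) : ℝ) ∧
      ∀ m : Fin r → ℤ, (∀ i, |m i| ≤ N) → ∑ i, (m i : ℝ) * g i ∈ Q := by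
  induction r with
  | zero =>
    intro N g hN
    refine ⟨{x | ∃ m : Fin 0 → ℤ, (∀ i, |m i| ≤ ((fun _ => N : Fin 0 → ℕ) i : ℤ)) ∧
      x = ∑ i, (m i : ℝ) * g i}, ⟨0, g, fun _ => N, le_rfl, rfl, ?_, by simp⟩, ?_⟩
    · intro m m' _ _ _
      exact Subsingleton.elim _ _
    · intro m hm
      exact ⟨m, hm, rfl⟩
  | succ r ih =>
    intro N g hN
    by_cases hp : ∀ m m' : Fin (r + 1) → ℤ, (∀ i, |m i| ≤ (N : ℤ)) → (∀ i, |m' i| ≤ (N : ℤ)) →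
      (∑ i, (m i : ℝ) * g i) = (∑ i, (m' i : ℝ) * g i) → m = m'
    · refine ⟨{x | ∃ m : Fin (r + 1) → ℤ, (∀ i, |m i| ≤ ((fun _ => N : Fin (r + 1) → ℕ) i : ℤ)) ∧
        x = ∑ i, (m i : ℝ) * g i}, ⟨r + 1, g, fun _ => N, le_rfl, rfl, hp, ?_⟩,
        fun m hm => ⟨m, hm, rfl⟩⟩
      rw [Finset.prod_const, Finset.card_univ, Fintype.card_fin]
      have h1 : (2 * N + 1) ^ (r + 1) ≤ (4 * N) ^ ((r + 1) * 2 ^ (r + 1)) :=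
        (Nat.pow_le_pow_left (by omega) _).trans
          (Nat.pow_le_pow_right (by omega) (Nat.le_mul_of_pos_right _ (by positivity)))
      exact_mod_cast h1
    · push Not at hp
      obtain ⟨m, m', hm, hm', heq, hne⟩ := hp
      obtain ⟨t, ht⟩ : ∃ t, m t ≠ m' t := by
        by_contra hcon
        push Not at hcon
        exact hne (funext hcon)
      let w : Fin (r + 1) → ℤ := fun i => m i - m' i
      have hw0 : w t ≠ 0 := sub_ne_zero.2 ht
      have hw : ∀ i, |w i| ≤ 2 * N := fun i => by
        have := abs_sub (m i) (m' i)
        have := hm i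
        have := hm' i
        simp only [w]
        linarith
      have hsum : ∑ i, (w i : ℝ) * g i = 0 := by
        simp only [w, Int.cast_sub, sub_mul, Finset.sum_sub_distrib]
        exact sub_eq_zero.2 heq
      have hwt : (w t : ℝ) ≠ 0 := by exact_mod_cast hw0
      obtain ⟨Q, ⟨r', g', N', hr', hQ, hprop, hsize⟩, hmem⟩ :=
        ih (4 * N ^ 2) (fun i => g (t.succAbove i) / w t) (by nlinarith)
      refine ⟨Q, ⟨r', g', N', by omega, hQ, hprop, hsize.trans ?_⟩, fun c hc => ?_⟩
      · have h1 : (4 * (4 * N ^ 2)) ^ (r * 2 ^ r) ≤ (4 * N) ^ ((r + 1) * 2 ^ (r + 1)) := by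
          rw [show 4 * (4 * N ^ 2) = (4 * N) ^ 2 by ring, ← pow_mul]
          refine Nat.pow_le_pow_right (by omega) ?_
          rw [pow_succ]
          nlinarith [Nat.one_le_two_pow (n := r)]
        exact_mod_cast h1
      · have key := hmem (fun i => c (t.succAbove i) * w t - c t * w (t.succAbove i)) fun i => ?_
        · convert key using 1
          rw [Fin.sum_univ_succAbove _ t] at hsum ⊢
          have hgt : g t = - (∑ i, (w (t.succAbove i) : ℝ) * g (t.succAbove i)) / w t := by
            field_simp
            linarith
          rw [hgt]
          push_cast
          have e : ∀ i : Fin r, ((c (t.succAbove i) : ℝ) * w t - c t * w (t.succAbove i)) *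
              (g (t.succAbove i) / w t) = c (t.succAbove i) * g (t.succAbove i) -
                c t / w t * (w (t.succAbove i) * g (t.succAbove i)) := fun i => by
            field_simp
          simp only [e, Finset.sum_sub_distrib, ← Finset.mul_sum]
          field_simp
          ring
        · have h1 := abs_sub (c (t.succAbove i) * w t) (c t * w (t.succAbove i))
          rw [abs_mul, abs_mul] at h1
          have h2 := mul_le_mul (hc (t.succAbove i)) (hw t) (abs_nonneg _) (by positivity)
          have h3 := mul_le_mul (hc t) (hw (t.succAbove i)) (abs_nonneg _) (by positivity)
          push_cast
          nlinarith

open Filter in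
lemma eventually_scale (ε C μ : ℝ) (hε0 : 0 < ε) (D m T : ℕ) :
    ∀ᶠ n : ℕ in atTop, 2 ≤ ⌊(n : ℝ) ^ (ε / 8)⌋₊ ∧ D ≤ ⌊(n : ℝ) ^ (ε / 8)⌋₊ ∧
      2 * (⌊(n : ℝ) ^ (ε / 8)⌋₊ ^ T) ^ m < 2 ^ ⌊(n : ℝ) ^ (ε / 8)⌋₊ ∧
      8 * C / μ * (n : ℝ) ^ (ε / 2) * Real.log n ≤ (n : ℝ) ^ ε := by
  have hq : Tendsto (fun n : ℕ => ⌊(n : ℝ) ^ (ε / 8)⌋₊) atTop atTop :=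
    tendsto_nat_floor_atTop.comp
      ((tendsto_rpow_atTop (by positivity)).comp tendsto_natCast_atTop_atTop)
  have h3 : ∀ᶠ q : ℕ in atTop, 2 * (q ^ T) ^ m < 2 ^ q := by
    have h := tendsto_pow_const_div_const_pow_of_one_lt (T * m) (one_lt_two : (1 : ℝ) < 2)
    filter_upwards [h.eventually_lt_const (show (0 : ℝ) < 1 / 2 by norm_num)] with q hq
    rw [div_lt_iff₀ (by positivity)] at hq
    have : (2 : ℝ) * (q ^ T) ^ m < 2 ^ q := by rw [← pow_mul]; linarith
    exact_mod_cast this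
  have h4 : ∀ᶠ n : ℕ in atTop, 8 * C / μ * (n : ℝ) ^ (ε / 2) * Real.log n ≤ (n : ℝ) ^ ε := by
    have h := (isLittleO_log_rpow_atTop (show 0 < ε / 2 by positivity)).bound
      (show 0 < 1 / (|8 * C / μ| + 1) by positivity)
    filter_upwards [tendsto_natCast_atTop_atTop.eventually h, eventually_ge_atTop 1] with n hn hn1
    have hn1' : (1 : ℝ) ≤ n := by exact_mod_cast hn1
    rw [Real.norm_of_nonneg (Real.log_nonneg hn1'), Real.norm_of_nonneg (by positivity),
      one_div_mul_eq_div, le_div_iff₀ (by positivity)] at hn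
    have hlog := Real.log_nonneg hn1'
    have habs := le_abs_self (8 * C / μ)
    have e : (n : ℝ) ^ ε = (n : ℝ) ^ (ε / 2) * (n : ℝ) ^ (ε / 2) := by
      rw [← Real.rpow_add (by positivity)]; congr 1; ring
    calc 8 * C / μ * (n : ℝ) ^ (ε / 2) * Real.log n
        = (n : ℝ) ^ (ε / 2) * (Real.log n * (8 * C / μ)) := by ring
      _ ≤ (n : ℝ) ^ (ε / 2) * (n : ℝ) ^ (ε / 2) := by
        refine mul_le_mul_of_nonneg_left (le_trans ?_ hn) (by positivity)
        exact mul_le_mul_of_nonneg_left (by linarith) hlog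
      _ = _ := e.symm
  filter_upwards [hq.eventually_ge_atTop 2, hq.eventually_ge_atTop D, hq.eventually h3, h4]
    with n h1 h2 h3 h4 using ⟨h1, h2, h3, h4⟩

/-- `b` has rank at most `D` outside `S`, up to a common denominator and with coefficients of size
at most `B`. -/
def HasSmallBasis {n : ℕ} (b : Fin n → ℝ) (S I : Finset (Fin n)) (N B : ℕ) : Prop :=
  ∀ i, i ∉ S → ∃ z : Fin n → ℤ, (∀ j, j ∉ I → z j = 0) ∧ (∀ j, |z j| ≤ B) ∧
    (N : ℝ) * b i = ∑ j, (z j : ℝ) * b j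

/-- The inverse Littlewood-Offord theorem for linear forms. -/
theorem exists_smallBasis_of_probEta (ε μ C : ℝ) (hε0 : 0 < ε) (hε1 : ε < 1) (hμ0 : 0 < μ)
    (hμ1 : μ ≤ 1) (hC : 0 < C) :
    ∃ D K n₀ : ℕ, ∀ n : ℕ, n₀ ≤ n → ∀ (b : Fin n → ℝ) (a : ℝ),
      (n : ℝ) ^ (-C) ≤ probEta μ (fun y : Fin n → ℝ => ∑ j, b j * y j = a) →
      ∃ (S I : Finset (Fin n)) (N : ℕ), (S.card : ℝ) ≤ (n : ℝ) ^ ε ∧ I.card ≤ D ∧ 1 ≤ N ∧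
        N ≤ n ^ K ∧ HasSmallBasis b S I N (n ^ K) := by
  set m := ⌈2 * C⌉₊ with hm
  set T' := ⌈8 / ε⌉₊ with hT'
  set T := 2 * T' with hT
  set D := T * m + 2 with hD
  obtain ⟨K, hK⟩ := exists_basis_of_growth D
  obtain ⟨n₁, hn₁⟩ := Filter.eventually_atTop.1 (eventually_scale ε C μ hε0 D m T)
  refine ⟨D, K, max n₁ 1, fun n hn b a hb => ?_⟩
  obtain ⟨hq2, hqD, hq2q, hlog⟩ := hn₁ n ((le_max_left _ _).trans hn)
  have hn1 : (1 : ℝ) ≤ n := by exact_mod_cast (le_max_right _ _).trans hn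
  have hn0 : (0 : ℝ) < n := by linarith
  set q := ⌊(n : ℝ) ^ (ε / 8)⌋₊ with hqdef
  have hqr : (q : ℝ) ≤ (n : ℝ) ^ (ε / 8) := Nat.floor_le (by positivity)
  have hqr' : (n : ℝ) ^ (ε / 8) < q + 1 := Nat.lt_floor_add_one _
  have hqn : q ≤ n := by
    have : (q : ℝ) ≤ n := hqr.trans (Real.rpow_le_self_of_one_le hn1 (by linarith))
    exact_mod_cast this
  have hq2' : (2 : ℝ) ≤ q := by exact_mod_cast hq2
  have hnT : n ≤ q ^ T := by
    have h1 : (n : ℝ) ≤ ((n : ℝ) ^ (ε / 8)) ^ T' := by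
      rw [← Real.rpow_natCast, ← Real.rpow_mul hn0.le]
      refine Real.self_le_rpow_of_one_le hn1 ?_
      have := Nat.le_ceil (8 / ε)
      calc 1 = ε / 8 * (8 / ε) := by field_simp
        _ ≤ _ := by gcongr
    have h2 : ((n : ℝ) ^ (ε / 8)) ^ T' ≤ ((q : ℝ) ^ 2) ^ T' := by
      refine pow_le_pow_left₀ (by positivity) ?_ _
      nlinarith
    have h3 : (n : ℝ) ≤ (q : ℝ) ^ T := by rw [hT, pow_mul]; exact h1.trans h2
    exact_mod_cast h3
  have hq0 : (0 : ℝ) < q := by linarith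
  obtain ⟨S, hS, hV⟩ := exists_small_growth (δ := 1 / (2 * (q : ℝ) ^ 4)) hμ0 hμ1 (by positivity)
    (by
      rw [div_le_one (by positivity)]
      nlinarith [one_le_pow₀ (show (1 : ℝ) ≤ q by linarith) (n := 4)])
    (show 0 < (n : ℝ) ^ (-C) by positivity) b a hb
  have hg : GrowthLE b S (q * q) (2 * n ^ m) := by
    intro V hVc
    have h1 := hV (q * q) (by push_cast; field_simp; norm_num) V hVc
    have h2 : 2 / ((n : ℝ) ^ (-C)) ^ 2 ≤ 2 * (n : ℝ) ^ m := by
      rw [← Real.rpow_natCast, ← Real.rpow_mul hn0.le, div_eq_mul_inv, ← Real.rpow_neg hn0.le,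
        ← Real.rpow_natCast (n : ℝ) m]
      refine mul_le_mul_of_nonneg_left (Real.rpow_le_rpow_of_exponent_le hn1 ?_) (by norm_num)
      have := Nat.le_ceil (2 * C)
      push_cast
      linarith
    exact_mod_cast h1.trans h2
  have hBdq : 2 * n ^ m < q ^ D := by
    have h1 : 2 * n ^ m ≤ 2 * (q ^ T) ^ m := by gcongr
    have h2 : 2 * (q ^ T) ^ m ≤ q ^ (T * m + 1) := by
      rw [pow_succ, ← pow_mul, mul_comm]; gcongr
    have h3 : q ^ (T * m + 1) < q ^ D := Nat.pow_lt_pow_right (by omega) (by omega)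
    omega
  have hBd2 : 2 * n ^ m < 2 ^ q := by
    have h1 : 2 * n ^ m ≤ 2 * (q ^ T) ^ m := by gcongr
    omega
  obtain ⟨I, N, hI, hN1, hNq, hz⟩ := hK q q (q * q) (2 * n ^ m) hq2 le_rfl le_rfl
    (Nat.mul_le_mul_right q hqD) hBdq hBd2 n b S hg
  have hqK : q ^ K ≤ n ^ K := Nat.pow_le_pow_left hqn K
  refine ⟨S, I, N, ?_, hI, hN1, hNq.trans hqK, fun i hi => ?_⟩
  · have hθ : (1 - μ * (1 / (2 * (q : ℝ) ^ 4)) / 2) ^ S.card ≤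
        Real.exp (-(μ * S.card / (4 * (q : ℝ) ^ 4))) := by
      have h1 := Real.add_one_le_exp (-(μ * (1 / (2 * (q : ℝ) ^ 4)) / 2))
      have h0 : 0 ≤ 1 - μ * (1 / (2 * (q : ℝ) ^ 4)) / 2 := by
        have : 1 / (2 * (q : ℝ) ^ 4) ≤ 1 := by
          rw [div_le_one (by positivity)]
          nlinarith [one_le_pow₀ (show (1 : ℝ) ≤ q by linarith) (n := 4)]
        have h5 : 0 < 1 / (2 * (q : ℝ) ^ 4) := by positivity
        nlinarith
      have h2 : 1 - μ * (1 / (2 * (q : ℝ) ^ 4)) / 2 ≤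
          Real.exp (-(μ * (1 / (2 * (q : ℝ) ^ 4)) / 2)) := by linarith
      refine (pow_le_pow_left₀ h0 h2 S.card).trans_eq ?_
      rw [← Real.exp_nat_mul]
      congr 1
      field_simp
      ring
    have h1 := hS.trans hθ
    have h2 := Real.log_le_log (by positivity) h1
    rw [Real.log_exp, Real.log_pow, Real.log_rpow hn0] at h2
    have h3 : μ * S.card / (4 * (q : ℝ) ^ 4) ≤ 2 * C * Real.log n := by
      push_cast at h2
      linarith
    have hq4 : (q : ℝ) ^ 4 ≤ (n : ℝ) ^ (ε / 2) := by
      refine (pow_le_pow_left₀ hq0.le hqr 4).trans_eq ?_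
      rw [← Real.rpow_natCast, ← Real.rpow_mul hn0.le]
      congr 1
      push_cast
      ring
    rw [div_le_iff₀ (by positivity)] at h3
    refine le_trans ?_ hlog
    have hlog0 := Real.log_nonneg hn1
    calc (S.card : ℝ) = μ * S.card / μ := by field_simp
      _ ≤ 2 * C * Real.log n * (4 * (q : ℝ) ^ 4) / μ := by gcongr
      _ = 8 * C / μ * (q : ℝ) ^ 4 * Real.log n := by ring
      _ ≤ _ := by gcongr
  · obtain ⟨z, hz0, hzq, hzb⟩ := hz i hi
    refine ⟨z, hz0, fun j => (hzq j).trans ?_, hzb⟩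
    exact_mod_cast hqK

/-- The probability of the outcome `s` for a family of iid copies of `η^μ`. -/
def etaWt (μ : ℝ) {ι : Type} [Fintype ι] (s : ι → Fin 3) : ℝ := ∏ i, etaW μ (s i)

lemma etaWt_nonneg {μ : ℝ} (hμ0 : 0 ≤ μ) (hμ1 : μ ≤ 1) {ι : Type} [Fintype ι] (s : ι → Fin 3) :
    0 ≤ etaWt μ s := by
  have h : ∀ x : Fin 3, 0 ≤ etaW μ x := fun x => by
    fin_cases x <;> simp [etaW] <;> linarith
  exact Finset.prod_nonneg fun i _ => h (s i)

lemma sum_etaWt (μ : ℝ) (n : ℕ) : ∑ s : Fin n → Fin 3, etaWt μ s = 1 := by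
  have h : ∑ x, etaW μ x = 1 := by
    simp [Fin.sum_univ_three, etaW]
  have := Finset.prod_univ_sum (fun _ : Fin n => (Finset.univ : Finset (Fin 3))) fun _ x => etaW μ x
  simp only [h, Finset.prod_const_one, Fintype.piFinset_univ] at this
  exact this.symm

lemma probEta_eq_sum_filter (μ : ℝ) {n : ℕ} (E : (Fin n → ℝ) → Prop) :
    probEta μ E = ∑ s : Fin n → Fin 3 with E fun i => etaV (s i), etaWt μ s := by
  rw [Finset.sum_filter, probEta]
  refine Finset.sum_congr (by congr!) fun s _ => ?_
  rw [mul_ite, mul_one, mul_zero, etaWt]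

lemma probEta_le_one {μ : ℝ} (hμ0 : 0 ≤ μ) (hμ1 : μ ≤ 1) {n : ℕ} (E : (Fin n → ℝ) → Prop) :
    probEta μ E ≤ 1 := by
  rw [probEta_eq_sum_filter, ← sum_etaWt μ n]
  exact Finset.sum_le_sum_of_subset_of_nonneg (Finset.filter_subset _ _)
    fun s _ _ => etaWt_nonneg hμ0 hμ1 s

lemma sum_le_probEta {μ : ℝ} (hμ0 : 0 ≤ μ) (hμ1 : μ ≤ 1) {n : ℕ} {E : (Fin n → ℝ) → Prop}
    {Y : Finset (Fin n → Fin 3)} (hY : ∀ s ∈ Y, E fun i => etaV (s i)) :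
    ∑ s ∈ Y, etaWt μ s ≤ probEta μ E := by
  rw [probEta_eq_sum_filter]
  refine Finset.sum_le_sum_of_subset_of_nonneg (fun s hs => ?_) fun s _ _ => etaWt_nonneg hμ0 hμ1 s
  simpa using hY s hs

/-- Conditioning a bilinear form on one of the two families of variables. -/
lemma probEta_bilinear (μ : ℝ) {n : ℕ} (A : Matrix (Fin n) (Fin n) ℝ) (a : ℝ) :
    probEta μ (fun xy : (Fin n ⊕ Fin n) → ℝ =>
        ∑ i, ∑ j, A i j * xy (Sum.inl i) * xy (Sum.inr j) = a) =
      ∑ t : Fin n → Fin 3, etaWt μ t *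
        probEta μ (fun x : Fin n → ℝ => ∑ i, (∑ j, A i j * etaV (t j)) * x i = a) := by
  have e : probEta μ (fun xy : (Fin n ⊕ Fin n) → ℝ =>
        ∑ i, ∑ j, A i j * xy (Sum.inl i) * xy (Sum.inr j) = a) =
      ∑ p : (Fin n → Fin 3) × (Fin n → Fin 3), (etaWt μ p.1 * etaWt μ p.2) *
        (if ∑ i, ∑ j, A i j * etaV (p.1 i) * etaV (p.2 j) = a then 1 else 0) := by
    rw [probEta]
    refine (Finset.sum_congr (by congr!) fun s _ => rfl).trans
      (Fintype.sum_equiv (Equiv.sumArrowEquivProdArrow (Fin n) (Fin n) (Fin 3)) _ _ fun s => ?_)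
    rw [Fintype.prod_sum_type]
    rfl
  rw [e, Fintype.sum_prod_type_right]
  refine Finset.sum_congr rfl fun t _ => ?_
  rw [probEta, Finset.mul_sum]
  refine Finset.sum_congr (by congr!) fun s _ => ?_
  have h : ∑ i, ∑ j, A i j * etaV (s i) * etaV (t j) =
      ∑ i, (∑ j, A i j * etaV (t j)) * etaV (s i) := by
    refine Finset.sum_congr rfl fun i _ => ?_
    rw [Finset.sum_mul]
    exact Finset.sum_congr rfl fun j _ => by ring
  simp only [h]
  rw [← mul_assoc]
  unfold etaWt
  ring

lemma half_le_sum_of_le_sum_mul {Ω : Type*} [Fintype Ω] {w f : Ω → ℝ} {p : ℝ}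
    (hw0 : ∀ t, 0 ≤ w t) (hw1 : ∑ t, w t = 1) (hp0 : 0 ≤ p) (hf : ∀ t, f t ≤ 1)
    (hp : p ≤ ∑ t, w t * f t) : p / 2 ≤ ∑ t with p / 2 ≤ f t, w t := by
  have h : ∑ t, w t * f t ≤ ∑ t, ((if p / 2 ≤ f t then w t else 0) + w t * (p / 2)) := by
    refine Finset.sum_le_sum fun t _ => ?_
    split_ifs with ht
    · have := mul_le_mul_of_nonneg_left (hf t) (hw0 t)
      have := mul_nonneg (hw0 t) (div_nonneg hp0 zero_le_two)
      linarith
    · have := mul_le_mul_of_nonneg_left (not_le.1 ht).le (hw0 t)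
      linarith
  rw [Finset.sum_add_distrib, ← Finset.sum_mul, hw1, ← Finset.sum_filter] at h
  linarith

lemma exists_div_le_sum_fiber {Ω Z : Type*} [DecidableEq Z] {w : Ω → ℝ} {Y : Finset Ω} {U : Finset Z} {φ : Ω → Z}
    {p : ℝ} {M : ℕ} (hp0 : 0 < p) (hp : p ≤ ∑ t ∈ Y, w t) (hφ : ∀ t ∈ Y, φ t ∈ U)
    (hU : U.card ≤ M) : ∃ u ∈ U, p / M ≤ ∑ t ∈ Y with φ t = u, w t := by
  have hUn : U.Nonempty := by
    have hY : Y.Nonempty := by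
      by_contra hcon
      rw [Finset.not_nonempty_iff_eq_empty] at hcon
      simp only [hcon, Finset.sum_empty] at hp
      linarith
    obtain ⟨t, ht⟩ := hY
    exact ⟨_, hφ t ht⟩
  have hU0 : (0 : ℝ) < U.card := by exact_mod_cast hUn.card_pos
  have hUM : (U.card : ℝ) ≤ M := by exact_mod_cast hU
  refine Finset.exists_le_sum_fiber_of_maps_to_of_nsmul_le_sum hφ hUn ?_
  rw [nsmul_eq_mul]
  refine le_trans ?_ hp
  rw [mul_div_assoc', div_le_iff₀ (hU0.trans_le hUM), mul_comm]
  exact mul_le_mul_of_nonneg_left hUM hp0.le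

/-- If every `S t` is small then few indices lie in `S t` for more than half of the `t`. -/
lemma card_filter_le_of_card_le {Ω ι : Type*} [Fintype ι] [DecidableEq ι] {w : Ω → ℝ} {Y : Finset Ω}
    {S : Ω → Finset ι} {s : ℝ} (hw0 : ∀ t, 0 ≤ w t) (hY : 0 < ∑ t ∈ Y, w t)
    (hS : ∀ t ∈ Y, ((S t).card : ℝ) ≤ s) :
    ((Finset.univ.filter fun i => (∑ t ∈ Y, w t) / 2 < ∑ t ∈ Y with i ∈ S t, w t).card : ℝ) ≤
      2 * s := by
  set W := ∑ t ∈ Y, w t with hW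
  set B := Finset.univ.filter fun i => W / 2 < ∑ t ∈ Y with i ∈ S t, w t with hB
  have h1 : (B.card : ℝ) * (W / 2) ≤ ∑ i ∈ B, ∑ t ∈ Y with i ∈ S t, w t := by
    rw [← nsmul_eq_mul]
    exact Finset.card_nsmul_le_sum _ _ _ fun i hi => (Finset.mem_filter.1 hi).2.le
  have h2 : ∑ i ∈ B, ∑ t ∈ Y with i ∈ S t, w t ≤ ∑ i, ∑ t ∈ Y with i ∈ S t, w t :=
    Finset.sum_le_sum_of_subset_of_nonneg (Finset.subset_univ _)
      fun i _ _ => Finset.sum_nonneg fun t _ => hw0 t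
  have h3 : ∑ i, ∑ t ∈ Y with i ∈ S t, w t = ∑ t ∈ Y, w t * (S t).card := by
    simp only [Finset.sum_filter]
    rw [Finset.sum_comm]
    refine Finset.sum_congr rfl fun t _ => ?_
    rw [← Finset.sum_filter, Finset.sum_const, nsmul_eq_mul, mul_comm]
    congr 3
    ext; simp
  have h4 : ∑ t ∈ Y, w t * (S t).card ≤ W * s := by
    rw [hW, Finset.sum_mul]
    exact Finset.sum_le_sum fun t ht => mul_le_mul_of_nonneg_left (hS t ht) (hw0 t)
  have h5 : (B.card : ℝ) * W ≤ 2 * s * W := by linarith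
  exact le_of_mul_le_mul_right h5 hY

lemma card_filter_card_le (n D : ℕ) (hn : D + 1 ≤ n) :
    (Finset.univ.filter fun I : Finset (Fin n) => I.card ≤ D).card ≤ n ^ (D + 1) := by
  have h : (Finset.univ.filter fun I : Finset (Fin n) => I.card ≤ D) ⊆
      (Finset.range (D + 1)).biUnion fun d => Finset.powersetCard d Finset.univ := by
    intro I hI
    have := (Finset.mem_filter.1 hI).2
    exact Finset.mem_biUnion.2 ⟨I.card, Finset.mem_range.2 (by omega),
      Finset.mem_powersetCard.2 ⟨Finset.subset_univ _, rfl⟩⟩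
  refine (Finset.card_le_card h).trans (Finset.card_biUnion_le.trans ?_)
  have h2 : ∀ d ∈ Finset.range (D + 1),
      (Finset.powersetCard d (Finset.univ : Finset (Fin n))).card ≤ n ^ D := by
    intro d hd
    rw [Finset.card_powersetCard, Finset.card_univ, Fintype.card_fin]
    exact (Nat.choose_le_pow n d).trans
      (Nat.pow_le_pow_right (by omega) (by have := Finset.mem_range.1 hd; omega))
  refine (Finset.sum_le_card_nsmul _ _ _ h2).trans ?_
  rw [Finset.card_range, smul_eq_mul, pow_succ, mul_comm]
  exact Nat.mul_le_mul_left _ hn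

/-- Integer vectors supported on `I` with entries of size at most `B`. -/
def boxVec {n : ℕ} (I : Finset (Fin n)) (B : ℕ) : Finset (Fin n → ℤ) :=
  Fintype.piFinset fun j => if j ∈ I then Finset.Icc (-(B : ℤ)) B else {0}

lemma mem_boxVec {n : ℕ} {I : Finset (Fin n)} {B : ℕ} {z : Fin n → ℤ} :
    z ∈ boxVec I B ↔ (∀ j, j ∉ I → z j = 0) ∧ ∀ j, |z j| ≤ B := by
  rw [boxVec, Fintype.mem_piFinset]
  refine ⟨fun h => ⟨fun j hj => by simpa [hj] using h j, fun j => ?_⟩, fun h j => ?_⟩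
  · have := h j
    split_ifs at this with hj
    · exact abs_le.2 (Finset.mem_Icc.1 this)
    · simp [Finset.mem_singleton.1 this]
  · split_ifs with hj
    · exact Finset.mem_Icc.2 (abs_le.1 (h.2 j))
    · simp [h.1 j hj]

lemma card_boxVec_le {n : ℕ} {I : Finset (Fin n)} {B D : ℕ} (hI : I.card ≤ D) :
    (boxVec I B).card ≤ (2 * B + 1) ^ D := by
  have h : ∀ j : Fin n, (if j ∈ I then Finset.Icc (-(B : ℤ)) B else {0}).card =
      if j ∈ I then 2 * B + 1 else 1 := fun j => by
    split_ifs
    · rw [Int.card_Icc]; omega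
    · simp
  rw [boxVec, Fintype.card_piFinset, Finset.prod_congr rfl fun j _ => h j,
    Finset.prod_ite_mem, Finset.univ_inter, Finset.prod_const]
  exact Nat.pow_le_pow_right (by omega) hI

lemma IsProperSymGAPSet.mono {Q : Set ℝ} {r r' : ℕ} {s s' : ℝ} (h : IsProperSymGAPSet Q r s)
    (hr : r ≤ r') (hs : s ≤ s') : IsProperSymGAPSet Q r' s' := by
  obtain ⟨d, g, N, hd, hQ, hp, hN⟩ := h
  exact ⟨d, g, N, hd.trans hr, hQ, hp, hN.trans hs⟩

/-- A small basis puts all coefficients outside `S` in a proper GAP. -/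
lemma HasSmallBasis.exists_gap {n : ℕ} {b : Fin n → ℝ} {S I : Finset (Fin n)} {N B D : ℕ}
    (h : HasSmallBasis b S I N B) (hI : I.card ≤ D) (hN : 1 ≤ N) (hB : 1 ≤ B) :
    ∃ Q : Set ℝ, IsProperSymGAPSet Q D (((4 * B) ^ (D * 2 ^ D) : ℕ) : ℝ) ∧
      ∀ i, i ∉ S → b i ∈ Q := by
  obtain ⟨Q, hQ, hmem⟩ := exists_proper_gap I.card B
    (fun t => b (I.equivFin.symm t) / N) hB
  refine ⟨Q, hQ.mono hI ?_, fun i hi => ?_⟩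
  · have : (4 * B) ^ (I.card * 2 ^ I.card) ≤ (4 * B) ^ (D * 2 ^ D) :=
      Nat.pow_le_pow_right (by omega)
        (Nat.mul_le_mul hI (Nat.pow_le_pow_right (by norm_num) hI))
    exact_mod_cast this
  · obtain ⟨z, hz0, hzB, hzb⟩ := h i hi
    have hN0 : (N : ℝ) ≠ 0 := by positivity
    convert hmem (fun t => z (I.equivFin.symm t)) fun t => hzB _ using 1
    rw [Equiv.sum_comp I.equivFin.symm fun j : I => (z j : ℝ) * (b j / N),
      Finset.sum_coe_sort I fun j => (z j : ℝ) * (b j / N),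
      Finset.sum_subset (Finset.subset_univ I) fun j _ hj => by simp [hz0 j hj],
      ← mul_right_inj' hN0, hzb, Finset.mul_sum]
    refine Finset.sum_congr rfl fun j _ => ?_
    field_simp

lemma exists_half_le_probEta {μ C : ℝ} {n : ℕ} (hn : 0 < n) (A : Matrix (Fin n) (Fin n) ℝ)
    (hA : (n : ℝ) ^ (-C) ≤ rhoBmu μ n A) :
    ∃ a : ℝ, (n : ℝ) ^ (-C) / 2 ≤ ∑ t : Fin n → Fin 3, etaWt μ t *
        probEta μ (fun x : Fin n → ℝ => ∑ i, (∑ j, A i j * etaV (t j)) * x i = a) := by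
  have h0 : 0 < (n : ℝ) ^ (-C) := by positivity
  obtain ⟨a, ha⟩ := exists_lt_of_lt_ciSup ((half_lt_self h0).trans_le hA)
  rw [probEta_bilinear] at ha
  exact ⟨a, ha.le⟩

/-- With polynomially large probability in `y`, the row forms `∑ j, A i j * y j` all lie, outside
a small set of rows, in the span of fixed boundedly many of them. -/
lemma exists_common_basis {μ C s : ℝ} {n D B : ℕ} (hμ0 : 0 < μ) (hμ1 : μ ≤ 1) (hn : 0 < n)
    (hD : D + 1 ≤ n) (A : Matrix (Fin n) (Fin n) ℝ)
    (hA : (n : ℝ) ^ (-C) ≤ rhoBmu μ n A)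
    (hlin : ∀ (b : Fin n → ℝ) (a : ℝ),
      (n : ℝ) ^ (-C) / 4 ≤ probEta μ (fun y : Fin n → ℝ => ∑ j, b j * y j = a) →
      ∃ (S I : Finset (Fin n)) (N : ℕ), (S.card : ℝ) ≤ s ∧ I.card ≤ D ∧ 1 ≤ N ∧
        N ≤ B ∧ HasSmallBasis b S I N B) :
    ∃ (I : Finset (Fin n)) (N : ℕ) (Y : Finset (Fin n → Fin 3))
      (S : (Fin n → Fin 3) → Finset (Fin n)), I.card ≤ D ∧ 1 ≤ N ∧ N ≤ B ∧
      (n : ℝ) ^ (-C) / 4 / ((n ^ (D + 1) * B : ℕ) : ℝ) ≤ ∑ t ∈ Y, etaWt μ t ∧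
      ∀ t ∈ Y, ((S t).card : ℝ) ≤ s ∧
        HasSmallBasis (fun i => ∑ j, A i j * etaV (t j)) (S t) I N B := by
  obtain ⟨a, ha⟩ := exists_half_le_probEta hn A hA
  have h0 : 0 < (n : ℝ) ^ (-C) := by positivity
  have hY := half_le_sum_of_le_sum_mul (etaWt_nonneg hμ0.le hμ1) (sum_etaWt μ n)
    (half_pos h0).le (fun t => probEta_le_one hμ0.le hμ1 _) ha
  rw [show (n : ℝ) ^ (-C) / 2 / 2 = (n : ℝ) ^ (-C) / 4 by ring] at hY
  set Y := Finset.univ.filter fun t : Fin n → Fin 3 => (n : ℝ) ^ (-C) / 4 ≤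
    probEta μ (fun x : Fin n → ℝ => ∑ i, (∑ j, A i j * etaV (t j)) * x i = a) with hYdef
  have hlinY : ∀ t ∈ Y, ∃ (S I : Finset (Fin n)) (N : ℕ), (S.card : ℝ) ≤ s ∧ I.card ≤ D ∧ 1 ≤ N ∧
      N ≤ B ∧ HasSmallBasis (fun i => ∑ j, A i j * etaV (t j)) S I N B :=
    fun t ht => hlin _ a (Finset.mem_filter.1 ht).2
  choose! S I N hS hI hN1 hNB hbasis using hlinY
  have hU : ((Finset.univ.filter fun I : Finset (Fin n) => I.card ≤ D) ×ˢ
      Finset.Icc 1 B).card ≤ n ^ (D + 1) * B := by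
    rw [Finset.card_product, Nat.card_Icc, Nat.add_sub_cancel]
    exact Nat.mul_le_mul_right _ (card_filter_card_le n D hD)
  obtain ⟨⟨I₀, N₀⟩, hu, hmass⟩ := exists_div_le_sum_fiber (φ := fun t => (I t, N t))
    (by positivity) hY (fun t ht => by
      simp [hI t ht, hN1 t ht, hNB t ht]) hU
  simp only [Finset.mem_product, Finset.mem_filter, Finset.mem_univ, true_and,
    Finset.mem_Icc] at hu
  refine ⟨I₀, N₀, _, S, hu.1, hu.2.1, hu.2.2, hmass, fun t ht => ?_⟩
  obtain ⟨htY, hte⟩ := Finset.mem_filter.1 ht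
  obtain ⟨rfl, rfl⟩ := Prod.mk.inj hte
  exact ⟨hS t htY, hbasis t htY⟩

/-- A row whose form is often spanned by the basis rows satisfies a fixed relation often. -/
lemma exists_row_relation {μ p : ℝ} {n D B N : ℕ} (hμ0 : 0 < μ) (hμ1 : μ ≤ 1) (hp : 0 < p)
    (A : Matrix (Fin n) (Fin n) ℝ) {I : Finset (Fin n)} (hI : I.card ≤ D)
    {Y : Finset (Fin n → Fin 3)} {S : (Fin n → Fin 3) → Finset (Fin n)} {i : Fin n}
    (hY : p ≤ ∑ t ∈ Y with i ∉ S t, etaWt μ t)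
    (hbasis : ∀ t ∈ Y, HasSmallBasis (fun i => ∑ j, A i j * etaV (t j)) (S t) I N B) :
    ∃ z : Fin n → ℤ, (∀ i₀, |z i₀| ≤ B) ∧ p / (((2 * B + 1) ^ D : ℕ) : ℝ) ≤
      probEta μ (fun y : Fin n → ℝ =>
        ∑ j, ((N : ℝ) * A i j + ∑ i₀ ∈ I, (z i₀ : ℝ) * A i₀ j) * y j = 0) := by
  have hz : ∀ t ∈ Y.filter fun t => i ∉ S t, ∃ z ∈ boxVec I B,
      (N : ℝ) * ∑ j, A i j * etaV (t j) = ∑ i₀, (z i₀ : ℝ) * ∑ j, A i₀ j * etaV (t j) := by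
    intro t ht
    obtain ⟨htY, hti⟩ := Finset.mem_filter.1 ht
    obtain ⟨z, hz0, hzB, hz⟩ := hbasis t htY i hti
    exact ⟨z, mem_boxVec.2 ⟨hz0, hzB⟩, hz⟩
  choose! z hzU hz using hz
  obtain ⟨z₀, hz₀, hmass⟩ := exists_div_le_sum_fiber hp hY hzU (card_boxVec_le hI)
  obtain ⟨hz₀I, hz₀B⟩ := mem_boxVec.1 hz₀
  refine ⟨-z₀, fun i₀ => by simpa using hz₀B i₀, hmass.trans (sum_le_probEta hμ0.le hμ1 ?_)⟩
  intro t ht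
  obtain ⟨htY, rfl⟩ := Finset.mem_filter.1 ht
  have h := hz t htY
  rw [← Finset.sum_subset (s₁ := I) (f := fun i₀ => (z t i₀ : ℝ) * ∑ j, A i₀ j * etaV (t j))
    (Finset.subset_univ I) fun j _ hj => by simp [hz₀I j hj]] at h
  simp only [add_mul, Finset.sum_add_distrib, Pi.neg_apply, Int.cast_neg, neg_mul,
    Finset.sum_neg_distrib, Finset.sum_mul]
  rw [Finset.sum_comm]
  simp only [mul_assoc, ← Finset.mul_sum]
  linarith

lemma rpow_neg_div_le {C M : ℝ} {n k : ℕ} (hn : 0 < n) (hM0 : 0 < M) (hM : M ≤ (n : ℝ) ^ k) :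
    (n : ℝ) ^ (-(C + k)) ≤ (n : ℝ) ^ (-C) / M := by
  have hn0 : (0 : ℝ) < n := by exact_mod_cast hn
  rw [le_div_iff₀ hM0, neg_add, Real.rpow_add hn0, mul_assoc]
  refine mul_le_of_le_one_right (by positivity) ?_
  rw [Real.rpow_neg hn0.le, Real.rpow_natCast, ← div_eq_inv_mul, div_le_one (by positivity)]
  exact hM

lemma natCast_le_rpow {n m k : ℕ} {c : ℝ} (hn : 1 ≤ n) (hm : m ≤ n ^ k) (hk : (k : ℝ) ≤ c) :
    (m : ℝ) ≤ (n : ℝ) ^ c := by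
  have h1 : (m : ℝ) ≤ (n : ℝ) ^ k := by exact_mod_cast hm
  rw [← Real.rpow_natCast] at h1
  exact h1.trans (Real.rpow_le_rpow_of_exponent_le (by exact_mod_cast hn) hk)

/-- Inverse Littlewood-Offord theorem for bilinear forms of iid copies of `η^μ`. -/
theorem inverse_LO_bilinear_mu (ε μ C : ℝ) (hε0 : 0 < ε) (hε1 : ε < 1)
    (hμ0 : 0 < μ) (hμ1 : μ ≤ 1) (hC : 0 < C) :
    ∃ r₀ : ℕ, ∃ c : ℝ, 0 < c ∧ ∃ n₀ : ℕ, ∀ n : ℕ, n₀ ≤ n →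
      ∀ A : Matrix (Fin n) (Fin n) ℝ, (n : ℝ) ^ (-C) ≤ rhoBmu μ n A →
        ∃ (I₀ J₀ I J : Finset (Fin n)) (k l : ℤ) (kk ll : Fin n → Fin n → ℤ)
          (a' : Fin n → Fin n → ℝ),
          I₀.card ≤ r₀ ∧ J₀.card ≤ r₀ ∧
          (n : ℝ) - c * (n : ℝ) ^ ε ≤ (I.card : ℝ) ∧
          (n : ℝ) - c * (n : ℝ) ^ ε ≤ (J.card : ℝ) ∧
          Disjoint I I₀ ∧ Disjoint J J₀ ∧
          k ≠ 0 ∧ l ≠ 0 ∧ |(k : ℝ)| ≤ (n : ℝ) ^ c ∧ |(l : ℝ)| ≤ (n : ℝ) ^ c ∧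
          (∀ i ∈ I, ∀ i₀ ∈ I₀, |(kk i i₀ : ℝ)| ≤ (n : ℝ) ^ c) ∧
          (∀ j ∈ J, ∀ j₀ ∈ J₀, |(ll j₀ j : ℝ)| ≤ (n : ℝ) ^ c) ∧
          ∀ i ∈ I,
            (∀ j ∈ J, A i j = a' i j / ((k : ℝ) * (l : ℝ))
                - (∑ i₀ ∈ I₀, (kk i i₀ : ℝ) * A i₀ j) / (k : ℝ)
                - (∑ j₀ ∈ J₀, (ll j₀ j : ℝ) * A i j₀) / (l : ℝ)) ∧
            (∃ Q : Set ℝ, IsProperSymGAPSet Q r₀ ((n : ℝ) ^ c) ∧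
              ((J.filter fun j => a' i j ∉ Q).card : ℝ) ≤ c * (n : ℝ) ^ ε) := by
  obtain ⟨D, K, n₁, hlin⟩ :=
    exists_smallBasis_of_probEta ε μ (C + (1 : ℕ)) hε0 hε1 hμ0 hμ1 (by positivity)
  obtain ⟨k, hk⟩ : ∃ k, k = 1 + (D + 1) + K + (K + 1) * D := ⟨_, rfl⟩
  obtain ⟨D', K', n₂, hlin'⟩ :=
    exists_smallBasis_of_probEta ε μ (C + k) hε0 hε1 hμ0 hμ1 (by positivity)
  obtain ⟨G, hG⟩ : ∃ G, G = (K' + 1) * (D' * 2 ^ D') := ⟨_, rfl⟩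
  obtain ⟨c, hc⟩ : ∃ c : ℝ, c = 2 + D + K + G := ⟨_, rfl⟩
  have hD0 : (0 : ℝ) ≤ D := Nat.cast_nonneg _
  have hK0 : (0 : ℝ) ≤ K := Nat.cast_nonneg _
  have hG0 : (0 : ℝ) ≤ G := Nat.cast_nonneg _
  have hc2 : 2 + (D : ℝ) ≤ c := by linarith
  have hcK : (K : ℝ) ≤ c := by linarith
  have hcG : (G : ℝ) ≤ c := by linarith
  refine ⟨max D D', c, by linarith, max (max n₁ n₂) (max 8 (D + 1)), fun n hn A hA => ?_⟩
  simp only [max_le_iff] at hn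
  obtain ⟨⟨hn₁, hn₂⟩, hn8, hnD⟩ := hn
  have hn0 : 0 < n := by omega
  have hn1 : (1 : ℝ) ≤ n := by exact_mod_cast hn0
  have hnε : 1 ≤ (n : ℝ) ^ ε := Real.one_le_rpow hn1 hε0.le
  have hB1 : 1 ≤ n ^ K := Nat.one_le_pow _ _ hn0
  obtain ⟨I₀, N, Y, S, hI₀, hN1, hNB, hmass, hYS⟩ := exists_common_basis hμ0 hμ1 hn0 hnD A hA
    fun b a hb => hlin n hn₁ b a ((rpow_neg_div_le hn0 (by norm_num : (0 : ℝ) < 4) (by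
      have : (8 : ℝ) ≤ n := by exact_mod_cast hn8
      rw [pow_one]; linarith)).trans hb)
  set W := ∑ t ∈ Y, etaWt μ t with hW
  have hW0 : 0 < W := lt_of_lt_of_le (by positivity) hmass
  have hbad := card_filter_le_of_card_le (etaWt_nonneg hμ0.le hμ1) hW0 fun t ht => (hYS t ht).1
  rw [← hW] at hbad
  set bad := Finset.univ.filter fun i => W / 2 < ∑ t ∈ Y with i ∈ S t, etaWt μ t with hbaddef
  have hrow : ∀ i, i ∉ bad → ∃ z : Fin n → ℤ, (∀ i₀, |z i₀| ≤ ((n ^ K : ℕ) : ℤ)) ∧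
      (n : ℝ) ^ (-(C + k)) ≤ probEta μ (fun y : Fin n → ℝ =>
        ∑ j, ((N : ℝ) * A i j + ∑ i₀ ∈ I₀, (z i₀ : ℝ) * A i₀ j) * y j = 0) := by
    intro i hi
    have hi' : W / 2 ≤ ∑ t ∈ Y with i ∉ S t, etaWt μ t := by
      have h1 : ∑ t ∈ Y with i ∈ S t, etaWt μ t ≤ W / 2 := by
        simpa [hbaddef] using hi
      have h2 := Finset.sum_filter_add_sum_filter_not Y (fun t => i ∈ S t) (etaWt μ)
      linarith
    obtain ⟨z, hz, hprob⟩ := exists_row_relation hμ0 hμ1 (half_pos hW0) A hI₀ hi'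
      fun t ht => (hYS t ht).2
    refine ⟨z, hz, le_trans ?_ hprob⟩
    have hM : 8 * (n ^ (D + 1) * n ^ K) * (2 * n ^ K + 1) ^ D ≤ n ^ k := by
      have h3 : 2 * n ^ K + 1 ≤ n ^ (K + 1) := by rw [pow_succ]; nlinarith
      calc 8 * (n ^ (D + 1) * n ^ K) * (2 * n ^ K + 1) ^ D
          ≤ n * (n ^ (D + 1) * n ^ K) * (n ^ (K + 1)) ^ D := by gcongr
        _ = n ^ k := by rw [hk]; ring
    have hM' : ((8 * (n ^ (D + 1) * n ^ K) * (2 * n ^ K + 1) ^ D : ℕ) : ℝ) ≤ (n : ℝ) ^ k := by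
      exact_mod_cast hM
    refine (rpow_neg_div_le hn0 (by positivity) hM').trans ?_
    calc (n : ℝ) ^ (-C) / ((8 * (n ^ (D + 1) * n ^ K) * (2 * n ^ K + 1) ^ D : ℕ) : ℝ)
        = (n : ℝ) ^ (-C) / 4 / ((n ^ (D + 1) * n ^ K : ℕ) : ℝ) / 2 /
            (((2 * n ^ K + 1) ^ D : ℕ) : ℝ) := by
          push_cast
          field_simp
          norm_num
      _ ≤ _ := by gcongr
  choose! z hz hzprob using hrow
  have hN0 : (N : ℝ) ≠ 0 := by positivity
  refine ⟨I₀, ∅, Finset.univ \ (bad ∪ I₀), Finset.univ, N, 1, z, 0,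
    fun i j => (N : ℝ) * A i j + ∑ i₀ ∈ I₀, (z i i₀ : ℝ) * A i₀ j,
    hI₀.trans (le_max_left _ _), by simp, ?_, ?_, ?_, by simp, by omega, one_ne_zero, ?_, ?_, ?_,
    by simp, fun i hi => ⟨fun j _ => ?_, ?_⟩⟩
  · have h1 : n ≤ (Finset.univ \ (bad ∪ I₀)).card + (bad.card + I₀.card) := by
      have h2 := Finset.card_sdiff_add_card_eq_card (Finset.subset_univ (bad ∪ I₀))
      rw [Finset.card_univ, Fintype.card_fin] at h2
      have h3 := Finset.card_union_le bad I₀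
      omega
    have h1' : (n : ℝ) ≤ (Finset.univ \ (bad ∪ I₀)).card + (bad.card + I₀.card) := by
      exact_mod_cast h1
    have h4 : (I₀.card : ℝ) ≤ D := by exact_mod_cast hI₀
    have h5 := mul_le_mul_of_nonneg_right hc2 (zero_le_one.trans hnε)
    have h6 := le_mul_of_one_le_right hD0 hnε
    linarith
  · rw [Finset.card_univ, Fintype.card_fin]
    exact sub_le_self _ (by nlinarith)
  · exact Finset.disjoint_of_subset_right Finset.subset_union_right Finset.sdiff_disjoint
  · rw [Int.cast_natCast, Nat.abs_cast]
    exact natCast_le_rpow hn0 hNB hcK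
  · simpa using Real.one_le_rpow hn1 (by linarith)
  · intro i hi i₀ _
    have h1 := hz i (fun h => (Finset.mem_sdiff.1 hi).2 (Finset.mem_union_left _ h)) i₀
    have h2 : |(z i i₀ : ℝ)| ≤ ((n ^ K : ℕ) : ℝ) := by exact_mod_cast h1
    exact h2.trans (natCast_le_rpow hn0 le_rfl hcK)
  · simp only [Int.cast_natCast, Int.cast_one, Finset.sum_empty]
    field_simp
    ring
  · obtain ⟨S', I', N', hS', hI', hN'1, -, hbasis⟩ := hlin' n hn₂ _ 0
      (hzprob i fun h => (Finset.mem_sdiff.1 hi).2 (Finset.mem_union_left _ h))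
    obtain ⟨Q, hQ, hmem⟩ := hbasis.exists_gap hI' hN'1 (Nat.one_le_pow _ _ hn0)
    refine ⟨Q, hQ.mono (le_max_right _ _) (natCast_le_rpow hn0 ?_ hcG), ?_⟩
    · rw [hG, pow_mul n]
      refine Nat.pow_le_pow_left ?_ _
      rw [pow_succ, mul_comm]
      exact Nat.mul_le_mul_left _ (by omega)
    · have h1 : (Finset.univ.filter fun j => (N : ℝ) * A i j +
          ∑ i₀ ∈ I₀, (z i i₀ : ℝ) * A i₀ j ∉ Q) ⊆ S' := fun j hj => by
        by_contra hcon
        exact (Finset.mem_filter.1 hj).2 (hmem j hcon)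
      have h2 := Finset.card_le_card h1
      have h3 : ((Finset.univ.filter fun j => (N : ℝ) * A i j +
          ∑ i₀ ∈ I₀, (z i i₀ : ℝ) * A i₀ j ∉ Q).card : ℝ) ≤ S'.card := by exact_mod_cast h2
      refine h3.trans (hS'.trans ?_)
      nlinarith

end
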